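/- Suppose log³ n ≪ d = p(n−1) = o(n). Let i ≥ 1 be the largest integer such that d^i = o(n) and let c = d^{i+1}/n. Suppose e^c > (log n)/(3 log log n) and c ≤ 3 log n. Then for G ∈ G(n,p), asymptotically almost surely β(G) ≥ (i/(i+1) + o(1)) · (d^i/n + e^{−c})^{−1} · log n. -/

import Mathlib

open Filter Real Asymptotics
open scoped Topology

/-- `R` is a resolving set of the graph `G`: every pair of distinct vertices is
distinguished by its distances to some vertex of `R`. -/
def Resolves {V : Type*} (G : SimpleGraph V) (R : Set V) : Prop :=
  ∀ ⦃v w : V⦄, v ≠ w → ∃ u ∈ R, G.dist u v ≠ G.dist u w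

/-- The metric dimension of a graph `G`: the smallest cardinality of a resolving set. -/
noncomputable def metricDim {V : Type*} (G : SimpleGraph V) : ℕ :=
  sInf {k : ℕ | ∃ R : Set V, R.Finite ∧ R.ncard = k ∧ Resolves G R}

/-- The `G(n,p)` probability weight of a single graph on `Fin n`. -/
noncomputable def gnpWeight (n : ℕ) (p : ℝ) (G : SimpleGraph (Fin n)) : ℝ :=
  p ^ Nat.card G.edgeSet * (1 - p) ^ (n.choose 2 - Nat.card G.edgeSet)

/-- The probability of an event `A` under the binomial random graph `G(n,p)`. -/
noncomputable def gnpProb (n : ℕ) (p : ℝ) (A : Set (SimpleGraph (Fin n))) : ℝ :=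
  ∑' G : SimpleGraph (Fin n), A.indicator (gnpWeight n p) G

/-- `S(v,i)`: the set of vertices at graph distance exactly `i` from `v`. -/
def gSphere {V : Type*} (G : SimpleGraph V) (v : V) (i : ℕ) : Set V :=
  {u | G.Reachable v u ∧ G.dist v u = i}

/-- `N(v,i)`: the set of vertices at graph distance at most `i` from `v`. -/
def gBall {V : Type*} (G : SimpleGraph V) (v : V) (i : ℕ) : Set V :=
  {u | G.Reachable v u ∧ G.dist v u ≤ i}

/-- `S(V',i)`: union of the spheres around the vertices of `V'`. -/
def gSphereSet {V : Type*} (G : SimpleGraph V) (W : Set V) (i : ℕ) : Set V :=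
  ⋃ v ∈ W, gSphere G v i

/-- `N(V',i)`: union of the balls around the vertices of `V'`. -/
def gBallSet {V : Type*} (G : SimpleGraph V) (W : Set V) (i : ℕ) : Set V :=
  ⋃ v ∈ W, gBall G v i

section BernoulliCube

variable {ι : Type*} [Fintype ι]

/-- The weight of a point of the cube `ι → Bool` under independent Bernoulli coordinates. -/
noncomputable def bernWeight (p : ℝ) (ω : ι → Bool) : ℝ := ∏ i, if ω i then p else 1 - p

/-- The expectation of `f` under independent Bernoulli coordinates with parameter `p`. -/
noncomputable def bernExp (p : ℝ) [DecidableEq ι] (f : (ι → Bool) → ℝ) : ℝ :=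
  ∑ ω, bernWeight p ω * f ω

open scoped Classical in
/-- The probability of the event `A` under independent Bernoulli coordinates. -/
noncomputable def bernProb (p : ℝ) [DecidableEq ι] (A : (ι → Bool) → Prop) : ℝ :=
  bernExp p fun ω => if A ω then 1 else 0

variable {p : ℝ}

theorem bernWeight_nonneg (h0 : 0 ≤ p) (h1 : p ≤ 1) (ω : ι → Bool) : 0 ≤ bernWeight p ω :=
  Finset.prod_nonneg fun i _ => by split_ifs <;> linarith

variable [DecidableEq ι]

theorem bernExp_prod_coord (g : ι → Bool → ℝ) :
    bernExp p (fun ω => ∏ i, g i (ω i)) = ∏ i, (p * g i true + (1 - p) * g i false) := by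
  have := Finset.prod_univ_sum (fun _ : ι => (Finset.univ : Finset Bool))
    (fun i b => (if b then p else 1 - p) * g i b)
  simp only [Fintype.piFinset_univ] at this
  simp only [bernExp, bernWeight, ← Finset.prod_mul_distrib]
  rw [← this]
  refine Finset.prod_congr rfl fun i _ => ?_
  simp

theorem bernExp_prod_coord_finset (A : Finset ι) (g : Bool → ℝ) :
    bernExp p (fun ω => ∏ i ∈ A, g (ω i)) = (p * g true + (1 - p) * g false) ^ A.card := by
  have := bernExp_prod_coord (p := p) (fun (i : ι) b => if i ∈ A then g b else 1)
  simp only [Finset.prod_ite_mem, Finset.univ_inter] at this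
  rw [this]
  rw [← Finset.prod_const, ← Finset.prod_subset (Finset.subset_univ A)]
  · exact Finset.prod_congr rfl fun i hi => by simp [hi]
  · intro i _ hi; simp [hi]

theorem bernExp_const (a : ℝ) : bernExp p (fun _ : ι → Bool => a) = a := by
  have h := bernExp_prod_coord_finset (p := p) (∅ : Finset ι) (fun _ => 1)
  simp only [bernExp, Finset.prod_empty, mul_one, Finset.card_empty, pow_zero] at h
  simp only [bernExp]
  rw [← Finset.sum_mul, h, one_mul]

theorem bernExp_mono (h0 : 0 ≤ p) (h1 : p ≤ 1) {f g : (ι → Bool) → ℝ} (h : ∀ ω, f ω ≤ g ω) :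
    bernExp p f ≤ bernExp p g :=
  Finset.sum_le_sum fun ω _ => mul_le_mul_of_nonneg_left (h ω) (bernWeight_nonneg h0 h1 ω)

theorem bernExp_nonneg (h0 : 0 ≤ p) (h1 : p ≤ 1) {f : (ι → Bool) → ℝ} (h : ∀ ω, 0 ≤ f ω) :
    0 ≤ bernExp p f :=
  Finset.sum_nonneg fun ω _ => mul_nonneg (bernWeight_nonneg h0 h1 ω) (h ω)

theorem bernExp_const_mul (a : ℝ) (f : (ι → Bool) → ℝ) :
    bernExp p (fun ω => a * f ω) = a * bernExp p f := by
  simp only [bernExp, Finset.mul_sum]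
  exact Finset.sum_congr rfl fun _ _ => by ring

theorem bernExp_add (f g : (ι → Bool) → ℝ) :
    bernExp p (fun ω => f ω + g ω) = bernExp p f + bernExp p g := by
  simp only [bernExp, mul_add, Finset.sum_add_distrib]

theorem bernExp_sum {κ : Type*} (s : Finset κ) (f : κ → (ι → Bool) → ℝ) :
    bernExp p (fun ω => ∑ k ∈ s, f k ω) = ∑ k ∈ s, bernExp p (f k) := by
  simp only [bernExp, Finset.mul_sum]
  exact Finset.sum_comm

theorem bernProb_le_one (h0 : 0 ≤ p) (h1 : p ≤ 1) (A : (ι → Bool) → Prop) : bernProb p A ≤ 1 := by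
  refine (bernExp_mono h0 h1 (g := fun _ => 1) fun ω => ?_).trans_eq (bernExp_const 1)
  split_ifs <;> norm_num

theorem bernProb_mono (h0 : 0 ≤ p) (h1 : p ≤ 1) {A B : (ι → Bool) → Prop} (h : ∀ ω, A ω → B ω) :
    bernProb p A ≤ bernProb p B := by
  refine bernExp_mono h0 h1 fun ω => ?_
  by_cases hA : A ω
  · simp [hA, h ω hA]
  · simp only [hA, if_false]; split_ifs <;> norm_num

theorem bernProb_or_le (h0 : 0 ≤ p) (h1 : p ≤ 1) (A B : (ι → Bool) → Prop) :
    bernProb p (fun ω => A ω ∨ B ω) ≤ bernProb p A + bernProb p B := by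
  unfold bernProb
  rw [← bernExp_add]
  refine bernExp_mono h0 h1 fun ω => ?_
  by_cases hA : A ω <;> by_cases hB : B ω <;> simp [hA, hB]

theorem bernProb_exists_le {κ : Type*} (h0 : 0 ≤ p) (h1 : p ≤ 1) (s : Finset κ)
    (A : κ → (ι → Bool) → Prop) :
    bernProb p (fun ω => ∃ k ∈ s, A k ω) ≤ ∑ k ∈ s, bernProb p (A k) := by
  classical
  unfold bernProb
  rw [← bernExp_sum]
  refine bernExp_mono h0 h1 fun ω => ?_
  split_ifs with h
  · obtain ⟨k, hk, hA⟩ := h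
    refine le_trans (by simp [hA]) (Finset.single_le_sum
      (f := fun k => if A k ω then (1 : ℝ) else 0) (fun k _ => ?_) hk)
    split_ifs <;> norm_num
  · exact Finset.sum_nonneg fun k _ => by split_ifs <;> norm_num

theorem bernProb_not (A : (ι → Bool) → Prop) :
    bernProb p (fun ω => ¬ A ω) = 1 - bernProb p A := by
  unfold bernProb
  rw [eq_sub_iff_add_eq, ← bernExp_add]
  refine Eq.trans ?_ (bernExp_const (ι := ι) (p := p) 1)
  congr 1; funext ω
  by_cases h : A ω <;> simp [h]

theorem bernWeight_piecewise_mul (J : Finset ι) (a b : ι → Bool) :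
    bernWeight p (J.piecewise a b) * bernWeight p (J.piecewise b a)
      = bernWeight p a * bernWeight p b := by
  simp only [bernWeight, ← Finset.prod_mul_distrib]
  refine Finset.prod_congr rfl fun i _ => ?_
  by_cases h : i ∈ J <;> simp [h, mul_comm]

/-- Resampling a set of coordinates which is itself determined by the coordinates outside it
does not change expectations. -/
theorem bernExp_resample (J : (ι → Bool) → Finset ι)
    (hJ : ∀ ω ω', J ((J ω).piecewise ω' ω) = J ω) (f : (ι → Bool) → ℝ) :
    bernExp p (fun ω => bernExp p fun ω' => f ((J ω).piecewise ω' ω)) = bernExp p f := by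
  have key : ∑ x : (ι → Bool) × (ι → Bool),
      bernWeight p x.1 * bernWeight p x.2 * f ((J x.1).piecewise x.2 x.1)
      = ∑ x : (ι → Bool) × (ι → Bool), bernWeight p x.1 * bernWeight p x.2 * f x.1 := by
    let e : (ι → Bool) × (ι → Bool) → (ι → Bool) × (ι → Bool) := fun x =>
      ((J x.1).piecewise x.2 x.1, (J x.1).piecewise x.1 x.2)
    have he : Function.Involutive e := by
      rintro ⟨a, b⟩
      have h : J ((J a).piecewise b a) = J a := hJ a b
      have h' : e ((J a).piecewise b a, (J a).piecewise a b) = (a, b) := by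
        simp only [e]
        rw [h]
        ext i <;> by_cases hi : i ∈ J a <;> simp [hi]
      exact h'
    refine Fintype.sum_equiv (he.toPerm) _ _ fun x => ?_
    simp only [Function.Involutive.coe_toPerm, e]
    rw [bernWeight_piecewise_mul, mul_comm (bernWeight p x.2)]
  rw [Fintype.sum_prod_type, Fintype.sum_prod_type] at key
  have h2 := bernExp_const (ι := ι) (p := p) 1
  simp only [bernExp, mul_one] at h2
  simp only [bernExp, Finset.mul_sum]
  simp only [← mul_assoc]
  rw [key]
  refine Finset.sum_congr rfl fun a _ => ?_
  dsimp only
  rw [← Finset.sum_mul, ← Finset.mul_sum, h2, mul_one]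

theorem bernExp_mul_of_disjoint {I J : Finset ι} (hIJ : Disjoint I J) {f g : (ι → Bool) → ℝ}
    (hf : DependsOn f (I : Set ι)) (hg : DependsOn g (J : Set ι)) :
    bernExp p (fun ω => f ω * g ω) = bernExp p f * bernExp p g := by
  rw [← bernExp_resample (fun _ => J) (fun _ _ => rfl), mul_comm, ← bernExp_const_mul]
  congr 1; funext ω
  rw [mul_comm, ← bernExp_const_mul]
  congr 1; funext ω'
  congr 1
  · refine hf fun i hi => ?_
    simp [Finset.disjoint_left.1 hIJ (Finset.mem_coe.1 hi)]
  · refine hg fun i hi => ?_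
    simp [Finset.mem_coe.1 hi]

theorem bernExp_prod_of_disjoint {κ : Type*} (T : Finset κ) (J : κ → Finset ι)
    (hJ : ∀ v ∈ T, ∀ w ∈ T, v ≠ w → Disjoint (J v) (J w)) (f : κ → (ι → Bool) → ℝ)
    (hf : ∀ v ∈ T, DependsOn (f v) (J v : Set ι)) :
    bernExp p (fun ω => ∏ v ∈ T, f v ω) = ∏ v ∈ T, bernExp p (f v) := by
  classical
  induction T using Finset.induction_on with
  | empty => simpa using bernExp_const (ι := ι) (p := p) 1
  | insert a T ha ih =>
    simp only [Finset.prod_insert ha]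
    rw [bernExp_mul_of_disjoint (I := J a) (J := T.biUnion J), ih]
    · intro v hv w hw; exact hJ v (by simp [hv]) w (by simp [hw])
    · intro v hv; exact hf v (by simp [hv])
    · rw [Finset.disjoint_biUnion_right]
      intro w hw
      exact hJ a (by simp) w (by simp [hw]) (by rintro rfl; exact ha hw)
    · exact hf a (by simp)
    · intro x y hxy
      refine Finset.prod_congr rfl fun v hv => hf v (by simp [hv]) fun i hi => hxy i ?_
      simp only [Finset.coe_biUnion, Set.mem_iUnion]
      exact ⟨v, hv, hi⟩

/-- Lower tail bound for the number of occurring events, for events depending on disjoint sets of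
coordinates. -/
theorem bernProb_card_le {κ : Type*} (h0 : 0 ≤ p) (h1 : p ≤ 1) (T : Finset κ) (J : κ → Finset ι)
    (hJ : ∀ v ∈ T, ∀ w ∈ T, v ≠ w → Disjoint (J v) (J w)) (A : κ → (ι → Bool) → Prop)
    [∀ ω, DecidablePred fun v => A v ω]
    (hA : ∀ v ∈ T, DependsOn (A v) (J v : Set ι)) {q : ℝ}
    (hq : ∀ v ∈ T, q ≤ bernProb p (A v)) {t a : ℝ} (ht : 0 ≤ t) :
    bernProb p (fun ω => ((T.filter fun v => A v ω).card : ℝ) ≤ a)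
      ≤ exp (t * a - T.card * (q * (1 - exp (-t)))) := by
  classical
  let f : κ → (ι → Bool) → ℝ := fun v ω => if A v ω then exp (-t) else 1
  have hexp : exp (-t) ≤ 1 := exp_le_one_iff.2 (by linarith)
  have hbound : ∀ v ∈ T, bernExp p (f v) ≤ exp (-(q * (1 - exp (-t)))) := by
    intro v hv
    have : bernExp p (f v) = 1 + (-(1 - exp (-t))) * bernProb p (A v) := by
      have hc := bernExp_const (ι := ι) (p := p) 1
      rw [bernProb, ← bernExp_const_mul]
      refine Eq.trans ?_ (congrArg (· + _) hc)
      rw [← bernExp_add]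
      congr 1; funext ω
      by_cases h : A v ω <;> simp [f, h]
    rw [this]
    have h3 := add_one_le_exp (-(q * (1 - exp (-t))))
    have h4 := mul_le_mul_of_nonneg_right (hq v hv) (sub_nonneg.2 hexp)
    linarith
  calc bernProb p (fun ω => ((T.filter fun v => A v ω).card : ℝ) ≤ a)
      ≤ bernExp p (fun ω => exp (t * a) * ∏ v ∈ T, f v ω) := by
        refine bernExp_mono h0 h1 fun ω => ?_
        have hprod : ∏ v ∈ T, f v ω = exp (-t * (T.filter fun v => A v ω).card) := by
          simp only [f, Finset.prod_ite, Finset.prod_const, one_pow, mul_one]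
          rw [← exp_nat_mul]; ring_nf
        rw [hprod, ← exp_add]
        split_ifs with h
        · apply one_le_exp
          nlinarith
        · positivity
    _ = exp (t * a) * ∏ v ∈ T, bernExp p (f v) := by
        rw [bernExp_const_mul, bernExp_prod_of_disjoint T J hJ]
        intro v hv x y hxy
        have := hA v hv hxy
        simp only [f, this]
    _ ≤ exp (t * a) * ∏ v ∈ T, exp (-(q * (1 - exp (-t)))) := by
        gcongr with v hv
        · intro v _
          exact bernExp_nonneg h0 h1 fun ω => by dsimp only [f]; split_ifs <;> positivity
        · exact hbound v hv
    _ = _ := by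
        rw [Finset.prod_const, ← exp_nat_mul, ← exp_add]
        ring_nf

theorem bernProb_forall_false (A : Finset ι) :
    bernProb p (fun ω => ∀ i ∈ A, ω i = false) = (1 - p) ^ A.card := by
  classical
  have := bernExp_prod_coord_finset (p := p) A (fun b => if b then 0 else 1)
  simp only [if_true, mul_zero, zero_add, Bool.false_eq_true, if_false, mul_one] at this
  rw [← this, bernProb]
  congr 1; funext ω
  split_ifs with h
  · exact (Finset.prod_eq_one fun i hi => by simp [h i hi]).symm
  · push Not at h
    obtain ⟨i, hi, hω⟩ := h
    exact (Finset.prod_eq_zero hi (by simp [hω])).symm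

theorem bernProb_exists_true (A : Finset ι) :
    bernProb p (fun ω => ∃ i ∈ A, ω i = true) = 1 - (1 - p) ^ A.card := by
  rw [← bernProb_forall_false, ← bernProb_not]
  congr 1; funext ω
  simp

/-- Upper tail bound for the number of successes among the coordinates in `A`. -/
theorem bernProb_le_card (h0 : 0 ≤ p) (h1 : p ≤ 1) (A : Finset ι) {t a : ℝ} (ht : 0 ≤ t) :
    bernProb p (fun ω => a ≤ ((A.filter fun i => ω i = true).card : ℝ))
      ≤ exp (A.card * (p * (exp t - 1)) - t * a) := by
  classical
  calc bernProb p (fun ω => a ≤ ((A.filter fun i => ω i = true).card : ℝ))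
      ≤ bernExp p (fun ω => exp (-(t * a)) * ∏ i ∈ A, if ω i then exp t else 1) := by
        refine bernExp_mono h0 h1 fun ω => ?_
        simp only [Finset.prod_ite, Finset.prod_const, one_pow, mul_one]
        rw [← exp_nat_mul, ← exp_add]
        split_ifs with h
        · apply one_le_exp
          nlinarith
        · positivity
    _ = exp (-(t * a)) * (p * exp t + (1 - p)) ^ A.card := by
        rw [bernExp_const_mul, bernExp_prod_coord_finset A (fun b => if b then exp t else 1)]
        simp
    _ ≤ exp (-(t * a)) * exp (p * (exp t - 1)) ^ A.card := by
        have h2 := exp_pos t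
        have h3 : 0 ≤ p * exp t + (1 - p) := add_nonneg (mul_nonneg h0 h2.le) (by linarith)
        gcongr
        · have := add_one_le_exp (p * (exp t - 1))
          linarith
    _ = _ := by
        rw [← exp_nat_mul, ← exp_add]
        ring_nf

/-- Harris' inequality for products of nonnegative increasing functions. -/
theorem prod_bernExp_le {κ : Type*} (h0 : 0 ≤ p) (h1 : p ≤ 1) (Q : Finset κ)
    (f : κ → (ι → Bool) → ℝ) (hf0 : ∀ u ω, 0 ≤ f u ω) (hf : ∀ u, Monotone (f u)) :
    ∏ u ∈ Q, bernExp p (f u) ≤ bernExp p (fun ω => ∏ u ∈ Q, f u ω) := by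
  classical
  induction Q using Finset.induction_on with
  | empty => simp [bernExp_const]
  | insert a Q ha ih =>
    simp only [Finset.prod_insert ha]
    have hW : ∑ ω : ι → Bool, bernWeight p ω = 1 := by
      simpa [bernExp] using bernExp_const (ι := ι) (p := p) 1
    have := fkg (α := ι → Bool) (μ := bernWeight p) (f := f a) (g := fun ω => ∏ u ∈ Q, f u ω)
      (fun ω => bernWeight_nonneg h0 h1 ω) (fun ω => hf0 a ω)
      (fun ω => Finset.prod_nonneg fun u _ => hf0 u ω) (hf a)
      (fun x y hxy => Finset.prod_le_prod (fun u _ => hf0 u x) fun u _ => hf u hxy)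
      (fun x y => by
        simp only [bernWeight, ← Finset.prod_mul_distrib]
        refine le_of_eq (Finset.prod_congr rfl fun i _ => ?_)
        cases hx : x i <;> cases hy : y i <;> simp [hx, hy, mul_comm])
    rw [hW, one_mul] at this
    refine le_trans ?_ this
    exact mul_le_mul_of_nonneg_left ih (bernExp_nonneg h0 h1 (hf0 a))

end BernoulliCube

section Balls

variable {V : Type*} [Fintype V] [DecidableEq V]

open scoped Classical in
/-- The vertices outside `T` with a neighbour in `S`. -/
noncomputable def outNbrs (G : SimpleGraph V) (S T : Finset V) : Finset V :=
  Finset.univ.filter fun w => w ∉ T ∧ ∃ u ∈ S, G.Adj u w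

/-- The vertices at distance less than `j` from the set `R`. -/
noncomputable def ballLT (G : SimpleGraph V) (R : Finset V) : ℕ → Finset V
  | 0 => ∅
  | j + 1 => R ∪ (ballLT G R j ∪ outNbrs G (ballLT G R j) ∅)

variable {G : SimpleGraph V} {R : Finset V}

theorem mem_outNbrs {S T : Finset V} {w : V} :
    w ∈ outNbrs G S T ↔ w ∉ T ∧ ∃ u ∈ S, G.Adj u w := by
  simp [outNbrs]

theorem mem_ballLT {j : ℕ} {w : V} :
    w ∈ ballLT G R j ↔ ∃ u ∈ R, ∃ P : G.Walk u w, P.length < j := by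
  induction j generalizing w with
  | zero => simp [ballLT]
  | succ j ih =>
    simp only [ballLT, Finset.mem_union, mem_outNbrs, ih]
    constructor
    · rintro (h | ⟨u, hu, P, hP⟩ | ⟨-, x, ⟨u, hu, P, hP⟩, hx⟩)
      · exact ⟨w, h, .nil, by simp⟩
      · exact ⟨u, hu, P, by omega⟩
      · exact ⟨u, hu, P.concat hx, by simp; omega⟩
    · rintro ⟨u, hu, P, hP⟩
      induction P using SimpleGraph.Walk.concatRec with
      | Hnil => exact Or.inl hu
      | Hconcat Q hx _ =>
        simp only [SimpleGraph.Walk.length_concat] at hP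
        exact Or.inr (Or.inr ⟨by simp, _, ⟨_, hu, Q, by omega⟩, hx⟩)

theorem ballLT_mono {j k : ℕ} (h : j ≤ k) : ballLT G R j ⊆ ballLT G R k := by
  intro w hw
  obtain ⟨u, hu, P, hP⟩ := mem_ballLT.1 hw
  exact mem_ballLT.2 ⟨u, hu, P, by omega⟩

theorem ballLT_subset {R' : Finset V} (h : R ⊆ R') (j : ℕ) : ballLT G R j ⊆ ballLT G R' j := by
  intro w hw
  obtain ⟨u, hu, P, hP⟩ := mem_ballLT.1 hw
  exact mem_ballLT.2 ⟨u, h hu, P, hP⟩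

theorem ballLT_union (R R' : Finset V) (j : ℕ) :
    ballLT G (R ∪ R') j = ballLT G R j ∪ ballLT G R' j := by
  ext w
  simp only [mem_ballLT, Finset.mem_union]
  constructor
  · rintro ⟨u, h | h, P⟩
    · exact Or.inl ⟨u, h, P⟩
    · exact Or.inr ⟨u, h, P⟩
  · rintro (⟨u, h, P⟩ | ⟨u, h, P⟩)
    · exact ⟨u, Or.inl h, P⟩
    · exact ⟨u, Or.inr h, P⟩

theorem subset_ballLT {j : ℕ} (hj : 1 ≤ j) : R ⊆ ballLT G R j := fun u hu =>
  mem_ballLT.2 ⟨u, hu, .nil, by simpa using Nat.pos_of_ne_zero (by omega)⟩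

theorem mem_ballLT_succ_of_adj {j : ℕ} {x w : V} (hx : x ∈ ballLT G R j) (h : G.Adj x w) :
    w ∈ ballLT G R (j + 1) := by
  simp only [ballLT, Finset.mem_union, mem_outNbrs]
  exact Or.inr (Or.inr ⟨by simp, x, hx, h⟩)

theorem ballLT_succ {j : ℕ} (hj : 1 ≤ j) :
    ballLT G R (j + 1) = ballLT G R j ∪ outNbrs G (ballLT G R j) ∅ := by
  change R ∪ _ = _
  rw [Finset.union_eq_right]
  exact (subset_ballLT hj).trans Finset.subset_union_left

theorem ballLT_congr {G' : SimpleGraph V} {j : ℕ}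
    (h : ∀ u ∈ ballLT G R j, ∀ w, G.Adj u w ↔ G'.Adj u w) {k : ℕ} (hk : k ≤ j + 1) :
    ballLT G' R k = ballLT G R k := by
  induction k with
  | zero => rfl
  | succ k ih =>
    simp only [ballLT]
    rw [ih (by omega)]
    congr 2
    ext w
    simp only [mem_outNbrs]
    refine and_congr_right fun _ => exists_congr fun u => and_congr_right fun hu => ?_
    exact (h u (ballLT_mono (by omega) hu) w).symm

theorem dist_eq_of_mem_ballLT {j : ℕ} {u v : V} (hu : u ∈ R) (hv : v ∉ ballLT G R j)
    (hv' : v ∈ ballLT G {u} (j + 1)) : G.Reachable u v ∧ G.dist u v = j := by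
  obtain ⟨x, hx, P, hP⟩ := mem_ballLT.1 hv'
  obtain rfl := Finset.mem_singleton.1 hx
  refine ⟨⟨P⟩, le_antisymm ((SimpleGraph.dist_le P).trans (by omega)) ?_⟩
  by_contra! h
  obtain ⟨Q, hQ⟩ := SimpleGraph.Reachable.exists_walk_length_eq_dist ⟨P⟩
  exact hv (mem_ballLT.2 ⟨x, hu, Q, by omega⟩)

/-- If many vertices are at distance exactly `j` from every vertex of `Q ⊆ R`, where `R \ Q` is
small, then two of them are not distinguished by `R`. -/
theorem not_resolves_of_card_lt {j : ℕ} {Q Γ : Finset V} (hQR : Q ⊆ R) (hQ : Q.Nonempty)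
    (h1 : ∀ v ∈ Γ, v ∉ ballLT G R j) (h2 : ∀ v ∈ Γ, ∀ u ∈ Q, v ∈ ballLT G {u} (j + 1))
    (hcard : (2 * j + 1) ^ (R \ Q).card < Γ.card) : ¬ Resolves G (R : Set V) := by
  intro hres
  obtain ⟨u₀, hu₀⟩ := hQ
  have hd : ∀ v ∈ Γ, ∀ u ∈ Q, G.Reachable u v ∧ G.dist u v = j := fun v hv u hu =>
    dist_eq_of_mem_ballLT (hQR hu) (h1 v hv) (h2 v hv u hu)
  have hrange : ∀ v ∈ Γ, ∀ u, G.dist u u₀ ≤ G.dist u v + j ∧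
      G.dist u v + j - G.dist u u₀ < 2 * j + 1 := by
    intro v hv u
    obtain ⟨hr, hdist⟩ := hd v hv u₀ hu₀
    by_cases hu : G.Reachable u u₀
    · have t1 := hr.symm.dist_triangle_left u
      have t2 := hr.dist_triangle_left u
      have t3 := G.dist_comm (u := u₀) (v := v)
      have t4 := G.dist_comm (u := u₀) (v := u)
      have t5 := G.dist_comm (u := v) (v := u)
      omega
    · have hu' : ¬ G.Reachable u v := fun h => hu (h.trans hr.symm)
      rw [SimpleGraph.dist_eq_zero_of_not_reachable hu,
        SimpleGraph.dist_eq_zero_of_not_reachable hu']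
      omega
  let f : V → (↥(R \ Q) → ℕ) := fun v u => G.dist u v + j - G.dist (u : V) u₀
  have hmaps : ∀ v ∈ Γ, f v ∈ Fintype.piFinset fun _ : ↥(R \ Q) => Finset.range (2 * j + 1) := by
    intro v hv
    simp only [Fintype.mem_piFinset, Finset.mem_range, f]
    exact fun u => (hrange v hv u).2
  obtain ⟨v, hv, w, hw, hvw, hf⟩ := Finset.exists_ne_map_eq_of_card_lt_of_maps_to
    (by simpa [Fintype.card_piFinset] using hcard) hmaps
  obtain ⟨u, hu, hne⟩ := hres hvw
  by_cases huQ : u ∈ Q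
  · rw [(hd v hv u huQ).2, (hd w hw u huQ).2] at hne
    exact hne rfl
  · have := congrFun hf ⟨u, by simpa [huQ] using hu⟩
    have a := (hrange v hv u).1
    have b := (hrange w hw u).1
    simp only [f] at this
    omega

/-- All degrees are at most `Δ`, and every set of at most `s` vertices has at least `d` times as
many neighbours outside itself and outside `T`. -/
structure Expands (G : SimpleGraph V) (T : Finset V) (Δ d s : ℝ) : Prop where
  degree_le : ∀ u, ((outNbrs G {u} ∅).card : ℝ) ≤ Δ
  le_card : ∀ S : Finset V, S.Nonempty → (S.card : ℝ) ≤ s → d * S.card ≤ (outNbrs G S (S ∪ T)).card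

variable {T : Finset V} {Δ d s : ℝ}

theorem Expands.card_outNbrs_le (h : Expands G T Δ d s) (S : Finset V) :
    ((outNbrs G S ∅).card : ℝ) ≤ S.card * Δ := by
  have : outNbrs G S ∅ ⊆ S.biUnion fun u => outNbrs G {u} ∅ := by
    intro w hw
    simp only [Finset.mem_biUnion, mem_outNbrs, Finset.mem_singleton] at hw ⊢
    obtain ⟨h0, u, hu, hw⟩ := hw
    exact ⟨u, hu, h0, u, rfl, hw⟩
  calc ((outNbrs G S ∅).card : ℝ) ≤ ∑ u ∈ S, ((outNbrs G {u} ∅).card : ℝ) := by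
        exact_mod_cast (Finset.card_le_card this).trans Finset.card_biUnion_le
    _ ≤ ∑ _u ∈ S, Δ := Finset.sum_le_sum fun u _ => h.degree_le u
    _ = _ := by simp

theorem Expands.card_ballLT_le (h : Expands G T Δ d s) (hΔ : 0 ≤ Δ) (W : Finset V) (j : ℕ) :
    ((ballLT G W (j + 1)).card : ℝ) ≤ W.card * (1 + Δ) ^ j := by
  induction j with
  | zero => simp [ballLT, outNbrs]
  | succ j ih =>
    rw [ballLT_succ (by omega)]
    have h1 : ((ballLT G W (j + 1) ∪ outNbrs G (ballLT G W (j + 1)) ∅).card : ℝ) ≤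
        (ballLT G W (j + 1)).card + (outNbrs G (ballLT G W (j + 1)) ∅).card := by
      exact_mod_cast Finset.card_union_le _ _
    have h2 := h.card_outNbrs_le (ballLT G W (j + 1))
    rw [pow_succ]
    nlinarith

theorem Expands.le_card_ballLT_sdiff (h : Expands G T Δ d s) (hΔ : 0 ≤ Δ) (hd : 0 ≤ d)
    {W : Finset V} (hW : W.Nonempty) {j : ℕ} (hs : W.card * (1 + Δ) ^ j ≤ s) :
    W.card * d ^ (j + 1) ≤ (ballLT G W (j + 2) \ T).card := by
  have hstep : ∀ k ≤ j, d * (ballLT G W (k + 1)).card ≤ (ballLT G W (k + 2) \ T).card := by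
    intro k hk
    have hle : ((ballLT G W (k + 1)).card : ℝ) ≤ s :=
      (h.card_ballLT_le hΔ W k).trans <| le_trans (by gcongr; linarith) hs
    refine (h.le_card _ (hW.mono (subset_ballLT (by omega))) hle).trans ?_
    refine Nat.cast_le.2 (Finset.card_le_card fun w hw => ?_)
    obtain ⟨h1, x, hx, hxw⟩ := mem_outNbrs.1 hw
    simp only [Finset.mem_union, not_or] at h1
    exact Finset.mem_sdiff.2 ⟨mem_ballLT_succ_of_adj hx hxw, h1.2⟩
  have hball : ∀ k ≤ j, W.card * d ^ k ≤ (ballLT G W (k + 1)).card := by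
    intro k
    induction k with
    | zero =>
      intro _
      simpa using Finset.card_le_card (subset_ballLT (G := G) (R := W) le_rfl)
    | succ k ih =>
      intro hk
      have h1 := mul_le_mul_of_nonneg_left (ih (by omega)) hd
      have h2 := hstep k (by omega)
      have h3 : ((ballLT G W (k + 2) \ T).card : ℝ) ≤ (ballLT G W (k + 2)).card := by
        exact_mod_cast Finset.card_le_card Finset.sdiff_subset
      rw [pow_succ]
      linarith
  have h1 := mul_le_mul_of_nonneg_left (hball j le_rfl) hd
  have h2 := hstep j le_rfl
  rw [pow_succ]
  linarith

/-- A Bonferroni type inequality. -/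
theorem sum_card_le_card_biUnion_add {κ V : Type*} [DecidableEq κ] [DecidableEq V] (M : Finset κ)
    (L : κ → Finset V)
    {τ : ℝ} (hL : ∀ u ∈ M, ∀ w ∈ M, u ≠ w → ((L u ∩ L w).card : ℝ) ≤ 2 * τ) (hτ : 0 ≤ τ) :
    ∑ u ∈ M, ((L u).card : ℝ) ≤ (M.biUnion L).card + (M.card : ℝ) ^ 2 * τ := by
  induction M using Finset.induction_on with
  | empty => simp
  | insert a M ha ih =>
    have ih' := ih fun u hu w hw => hL u (by simp [hu]) w (by simp [hw])
    have h1 : ((L a ∩ M.biUnion L).card : ℝ) ≤ M.card * (2 * τ) := by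
      rw [Finset.inter_biUnion]
      calc ((M.biUnion fun u => L a ∩ L u).card : ℝ) ≤ ∑ u ∈ M, ((L a ∩ L u).card : ℝ) := by
            exact_mod_cast Finset.card_biUnion_le
        _ ≤ ∑ _u ∈ M, 2 * τ := Finset.sum_le_sum fun u hu =>
            hL a (by simp) u (by simp [hu]) (by rintro rfl; exact ha hu)
        _ = _ := by simp
    have h2 : ((L a ∪ M.biUnion L).card : ℝ) + (L a ∩ M.biUnion L).card
        = (L a).card + (M.biUnion L).card := by
      exact_mod_cast Finset.card_union_add_card_inter _ _
    rw [Finset.sum_insert ha, Finset.biUnion_insert, Finset.card_insert_of_notMem ha]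
    push_cast
    nlinarith

/-- The vertices at distance at most `i` from `u` which are neither in `T` nor at distance less
than `i` from `R`. -/
noncomputable def freeBall (G : SimpleGraph V) (T R : Finset V) (i : ℕ) (u : V) : Finset V :=
  ballLT G {u} (i + 1) \ (T ∪ ballLT G R i)

open scoped Classical in
/-- In an expanding graph only few vertices have a small free ball. -/
theorem Expands.card_filter_freeBall_lt {i : ℕ} (h : Expands G T Δ d (2 * (1 + Δ) ^ i))
    (hd : 0 ≤ d) (hdΔ : d ≤ 1 + Δ) (hΔ : 0 ≤ Δ) (R : Finset V) {m : ℕ} {θ : ℝ}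
    (hm : R.card * (1 + Δ) ^ i
      < m * (θ * d ^ (i + 1) - m * ((1 + Δ) ^ (i + 1) - d ^ (i + 1)))) :
    (R.filter fun u =>
      ((freeBall G T R (i + 1) u).card : ℝ) < (1 - θ) * d ^ (i + 1)).card < m := by
  by_contra! hcon
  obtain ⟨M, hM, hMm⟩ := Finset.exists_subset_card_eq hcon
  set D := d ^ (i + 1)
  set D' := (1 + Δ) ^ (i + 1)
  have hDD : D ≤ D' := pow_le_pow_left₀ hd hdΔ _
  set U := ballLT G R (i + 1)
  let X : V → Finset V := fun u => ballLT G {u} (i + 2) \ T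
  have hX1 : ∀ u, ((X u).card : ℝ) ≤ D' := fun u => by
    have h1 := h.card_ballLT_le hΔ {u} (i + 1)
    have h2 : ((X u).card : ℝ) ≤ (ballLT G {u} (i + 2)).card := by
      exact_mod_cast Finset.card_le_card Finset.sdiff_subset
    simp only [Finset.card_singleton, Nat.cast_one, one_mul] at h1
    exact h2.trans h1
  have hpow : (0 : ℝ) ≤ (1 + Δ) ^ i := by positivity
  have hX2 : ∀ u, D ≤ (X u).card := fun u => by
    have := h.le_card_ballLT_sdiff hΔ hd (Finset.singleton_nonempty u) (j := i)
      (by rw [Finset.card_singleton]; push_cast; linarith)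
    simpa using this
  have hX3 : ∀ u w, u ≠ w → ((X u ∩ X w).card : ℝ) ≤ 2 * (D' - D) := fun u w huw => by
    have hc : ({u} ∪ {w} : Finset V).card = 2 := by
      rw [Finset.card_union_of_disjoint (by simpa using huw)]; simp
    have h1 := h.le_card_ballLT_sdiff hΔ hd (W := {u} ∪ {w}) (j := i) (by simp)
      (by rw [hc]; push_cast; exact le_rfl)
    rw [hc, ballLT_union, Finset.union_sdiff_distrib] at h1
    have h2 : ((X u ∪ X w).card : ℝ) + (X u ∩ X w).card = (X u).card + (X w).card := by
      exact_mod_cast Finset.card_union_add_card_inter _ _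
    have h3 := hX1 u
    have h4 := hX1 w
    push_cast at h1
    change 2 * D ≤ ((X u ∪ X w).card : ℝ) at h1
    linarith
  have hU : (U.card : ℝ) ≤ R.card * (1 + Δ) ^ i := h.card_ballLT_le hΔ R i
  have hloss : ∀ u ∈ M, θ * D ≤ ((X u ∩ U).card : ℝ) := fun u hu => by
    have h1 := (Finset.mem_filter.1 (hM hu)).2
    have h2 : freeBall G T R (i + 1) u = X u \ U := by
      ext x
      simp only [freeBall, X, U, Finset.mem_sdiff, Finset.mem_union]
      tauto
    have h3 : ((X u ∩ U).card : ℝ) + (X u \ U).card = (X u).card := by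
      exact_mod_cast Finset.card_inter_add_card_sdiff _ _
    rw [h2] at h1
    have := hX2 u
    linarith
  have hbon := sum_card_le_card_biUnion_add M (fun u => X u ∩ U) (τ := D' - D)
    (fun u _ w _ huw => le_trans (by
      exact_mod_cast Finset.card_le_card
        (Finset.inter_subset_inter Finset.inter_subset_left Finset.inter_subset_left))
      (hX3 u w huw)) (by linarith)
  have hsub : (((M.biUnion fun u => X u ∩ U).card : ℕ) : ℝ) ≤ U.card := by
    refine Nat.cast_le.2 (Finset.card_le_card ?_)
    exact Finset.biUnion_subset.2 fun u _ => Finset.inter_subset_right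
  have hsum : (m : ℝ) * (θ * D) ≤ ∑ u ∈ M, ((X u ∩ U).card : ℝ) := by
    rw [← hMm, ← nsmul_eq_mul]
    exact Finset.card_nsmul_le_sum _ _ _ hloss
  rw [hMm] at hbon
  nlinarith

theorem Expands.resolves_univ {h_s : 1 ≤ s} (h : Expands G T Δ d s) (hd : 0 < d) :
    Resolves G Set.univ := by
  intro v w hvw
  by_contra! hcon
  have h1 := h.le_card {v} (by simp) (by simpa using h_s)
  have h2 : (0 : ℝ) < (outNbrs G {v} ({v} ∪ T)).card := lt_of_lt_of_le (by simpa using hd) h1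
  obtain ⟨x, hx⟩ := Finset.card_pos.1 (Nat.cast_pos.1 h2)
  obtain ⟨-, y, hy, hyx⟩ := mem_outNbrs.1 hx
  obtain rfl := Finset.mem_singleton.1 hy
  by_cases hr : G.Reachable y w
  · have := hcon y trivial
    rw [SimpleGraph.dist_self] at this
    exact hvw ((hr.dist_eq_zero_iff).1 this.symm)
  · have := hcon x trivial
    rw [SimpleGraph.dist_eq_zero_of_not_reachable (u := x) (v := w)
      (fun h => hr (hyx.reachable.trans h)), SimpleGraph.dist_eq_one_iff_adj.2 hyx.symm] at this
    exact one_ne_zero this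

theorem Resolves.mono {W : Type*} {G : SimpleGraph W} {R R' : Set W} (h : Resolves G R)
    (hR : R ⊆ R') : Resolves G R' := fun _ _ hvw =>
  let ⟨u, hu, hne⟩ := h hvw
  ⟨u, hR hu, hne⟩

theorem exists_resolves_of_metricDim_le {W : Type*} [Fintype W] {G : SimpleGraph W}
    (hG : Resolves G Set.univ) {k : ℕ}
    (hk : metricDim G ≤ k) (hkV : k ≤ Fintype.card W) :
    ∃ R : Finset W, R.card = k ∧ Resolves G (R : Set W) := by
  obtain ⟨R, hfin, hcard, hR⟩ := Nat.sInf_mem (s := {k : ℕ | ∃ R : Set W, R.Finite ∧ R.ncard = k ∧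
    Resolves G R}) ⟨_, Set.univ, Set.finite_univ, rfl, hG⟩
  lift R to Finset W using hfin
  rw [Set.ncard_coe_finset] at hcard
  obtain ⟨R', hRR', -, hR'⟩ := Finset.exists_subsuperset_card_eq (Finset.subset_univ R)
    (hcard.trans_le hk) (by simpa using hkV)
  exact ⟨R', hR', hR.mono (by exact_mod_cast hRR')⟩

end Balls

section RandomGraph

variable {V : Type*} {p : ℝ}

/-- The graph whose edges are the pairs marked `true`. -/
def cubeGraph (ω : Sym2 V → Bool) : SimpleGraph V := SimpleGraph.fromEdgeSet {e | ω e = true}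

theorem cubeGraph_adj {ω : Sym2 V → Bool} {a b : V} :
    (cubeGraph ω).Adj a b ↔ ω s(a, b) = true ∧ a ≠ b := by
  simp [cubeGraph]

theorem gnpWeight_eq (n : ℕ) (G : SimpleGraph (Fin n)) :
    gnpWeight n p G = bernProb p fun ω => cubeGraph ω = G := by
  classical
  have h1 : bernProb p (fun ω : Sym2 (Fin n) → Bool => cubeGraph ω = G)
      = bernExp p fun ω => ∏ e : Sym2 (Fin n),
        if e.IsDiag then 1 else if (ω e = true ↔ e ∈ G.edgeSet) then 1 else 0 := by
    unfold bernProb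
    congr 1; funext ω
    split_ifs with h
    · refine (Finset.prod_eq_one fun e _ => ?_).symm
      induction e using Sym2.ind with | _ a b =>
      by_cases hab : a = b
      · simp [hab]
      · have : ω s(a, b) = true ↔ G.Adj a b := by
          rw [← h, cubeGraph_adj]; simp [hab]
        simp [this]
    · by_contra hne
      apply h
      have hne' := Finset.prod_ne_zero_iff.1 (Ne.symm hne)
      ext a b
      have hab := hne' s(a, b) (Finset.mem_univ _)
      rw [cubeGraph_adj]
      by_cases heq : a = b
      · simp [heq]
      · have : ω s(a, b) = true ↔ G.Adj a b := by
          by_contra hc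
          simp [heq, hc] at hab
        simp [heq, this]
  rw [h1, bernExp_prod_coord (fun (e : Sym2 (Fin n)) b =>
    if e.IsDiag then 1 else if (b = true ↔ e ∈ G.edgeSet) then 1 else 0)]
  have h2 : ∀ e : Sym2 (Fin n),
      (p * (if e.IsDiag then 1 else if (true = true ↔ e ∈ G.edgeSet) then 1 else 0) +
        (1 - p) * (if e.IsDiag then 1 else if (false = true ↔ e ∈ G.edgeSet) then 1 else 0))
      = if e.IsDiag then 1 else if e ∈ G.edgeSet then p else 1 - p := by
    intro e
    by_cases h : e.IsDiag <;> by_cases h' : e ∈ G.edgeSet <;> simp [h, h']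
  rw [Finset.prod_congr rfl fun e _ => h2 e]
  rw [Finset.prod_ite, Finset.prod_const_one, one_mul, Finset.prod_ite, Finset.prod_const,
    Finset.prod_const, gnpWeight]
  have h3 : (Finset.univ.filter fun e : Sym2 (Fin n) => ¬ e.IsDiag).card = n.choose 2 := by
    rw [← Fintype.card_subtype, Sym2.card_subtype_not_diag, Fintype.card_fin]
  have h4 : ((Finset.univ.filter fun e : Sym2 (Fin n) => ¬ e.IsDiag).filter
      fun e => e ∈ G.edgeSet).card = Nat.card G.edgeSet := by
    rw [Nat.card_eq_fintype_card, ← Set.toFinset_card]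
    congr 1
    ext e
    simp only [Finset.mem_filter, Finset.mem_univ, true_and, Set.mem_toFinset]
    exact ⟨fun h => h.2, fun h => ⟨G.not_isDiag_of_mem_edgeSet h, h⟩⟩
  have h5 := Finset.card_filter_add_card_filter_not
    (s := Finset.univ.filter fun e : Sym2 (Fin n) => ¬ e.IsDiag) (fun e => e ∈ G.edgeSet)
  rw [h3, h4] at h5
  rw [h4]
  congr 2
  omega

theorem gnpProb_eq (n : ℕ) (A : Set (SimpleGraph (Fin n))) :
    gnpProb n p A = bernProb p fun ω => cubeGraph ω ∈ A := by
  classical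
  rw [gnpProb, tsum_fintype]
  have : ∀ G, A.indicator (gnpWeight n p) G
      = bernExp p fun ω => if cubeGraph ω = G ∧ G ∈ A then 1 else 0 := by
    intro G
    by_cases hG : G ∈ A
    · simp [hG, gnpWeight_eq, bernProb]
    · simp [hG, bernExp_const]
  simp only [this]
  rw [← bernExp_sum, bernProb]
  congr 1; funext ω
  simp [ite_and]

variable [Fintype V] [DecidableEq V]

theorem bernProb_degree_gt_le (h0 : 0 ≤ p) (h1 : p ≤ 1) (u : V) {t Δ : ℝ} (ht : 0 ≤ t) :
    bernProb p (fun ω => ¬ ((outNbrs (cubeGraph ω) {u} ∅).card : ℝ) ≤ Δ)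
      ≤ exp ((Fintype.card V - 1) * (p * (exp t - 1)) - t * Δ) := by
  set A : Finset (Sym2 V) := (Finset.univ.erase u).image fun w => s(u, w)
  have hinj : Function.Injective fun w : V => s(u, w) := fun a b h => Sym2.congr_right.1 h
  have hA : (A.card : ℝ) = Fintype.card V - 1 := by
    rw [Finset.card_image_of_injective _ hinj, Finset.card_erase_of_mem (Finset.mem_univ _),
      Finset.card_univ, Nat.cast_sub (Fintype.card_pos_iff.2 ⟨u⟩), Nat.cast_one]
  rw [← hA]
  refine (bernProb_mono h0 h1 fun ω hω => ?_).trans (bernProb_le_card h0 h1 A ht)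
  refine (not_le.1 hω).le.trans (Nat.cast_le.2 ?_)
  rw [← Finset.card_image_of_injective _ hinj]
  refine Finset.card_le_card fun e he => ?_
  obtain ⟨w, hw, rfl⟩ := Finset.mem_image.1 he
  obtain ⟨-, x, hx, hxw⟩ := mem_outNbrs.1 hw
  obtain rfl := Finset.mem_singleton.1 hx
  rw [cubeGraph_adj] at hxw
  simp only [Finset.mem_filter, hxw.1, and_true, A, Finset.mem_image]
  exact ⟨w, by simp [hxw.2.symm], rfl⟩

theorem bernProb_outNbrs_lt_le (h0 : 0 ≤ p) (h1 : p ≤ 1) (S T : Finset V) {t a : ℝ} (ht : 0 ≤ t) :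
    bernProb p (fun ω => ¬ a ≤ ((outNbrs (cubeGraph ω) S (S ∪ T)).card : ℝ))
      ≤ exp (t * a - (S ∪ T)ᶜ.card * ((1 - (1 - p) ^ S.card) * (1 - exp (-t)))) := by
  classical
  let J : V → Finset (Sym2 V) := fun w => S.image fun x => s(x, w)
  have hinj : ∀ w : V, Function.Injective fun x : V => s(x, w) := fun w a b h => Sym2.congr_left.1 h
  refine (bernProb_mono h0 h1 fun ω hω => ?_).trans
    (bernProb_card_le h0 h1 (S ∪ T)ᶜ J ?_ (fun w ω => ∃ e ∈ J w, ω e = true) ?_ ?_ ht)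
  · refine le_trans (Nat.cast_le.2 (Finset.card_le_card fun w hw => ?_)) (not_le.1 hω).le
    simp only [Finset.mem_filter, Finset.mem_compl, J, Finset.mem_image] at hw
    obtain ⟨hw, e, ⟨x, hx, rfl⟩, he⟩ := hw
    refine mem_outNbrs.2 ⟨hw, x, hx, cubeGraph_adj.2 ⟨he, ?_⟩⟩
    rintro rfl
    exact hw (by simp [hx])
  · intro v hv w hw hvw
    simp only [Finset.mem_compl, Finset.mem_union, not_or] at hv hw
    rw [Finset.disjoint_left]
    intro e he he'
    obtain ⟨x, hx, rfl⟩ := Finset.mem_image.1 he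
    obtain ⟨y, hy, hxy⟩ := Finset.mem_image.1 he'
    simp only [Sym2.eq_iff] at hxy
    rcases hxy with ⟨-, h⟩ | ⟨rfl, -⟩
    · exact hvw h.symm
    · exact hv.1 hy
  · intro v _ x y hxy
    refine propext (exists_congr fun e => and_congr_right fun he => ?_)
    rw [hxy e he]
  · intro v _
    rw [bernProb_exists_true, Finset.card_image_of_injective _ (hinj v)]

theorem bernProb_not_expands_le (h0 : 0 ≤ p) (h1 : p ≤ 1) (T : Finset V) {Δ d s t κ : ℝ}
    (ht : 0 ≤ t)
    (hS : ∀ S : Finset V, S.Nonempty → (S.card : ℝ) ≤ s →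
      t * (d * S.card) - (S ∪ T)ᶜ.card * ((1 - (1 - p) ^ S.card) * (1 - exp (-t)))
        ≤ S.card * (-κ)) :
    bernProb p (fun ω => ¬ Expands (V := V) (cubeGraph ω) T Δ d s) ≤
      Fintype.card V * exp ((Fintype.card V - 1) * (p * (exp t - 1)) - t * Δ)
        + (exp (Fintype.card V * exp (-κ)) - 1) := by
  classical
  set F : Finset (Finset V) := Finset.univ.filter fun S => S.Nonempty ∧ (S.card : ℝ) ≤ s
  calc bernProb p (fun ω => ¬ Expands (V := V) (cubeGraph ω) T Δ d s)
      ≤ bernProb p (fun ω =>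
        (∃ u ∈ (Finset.univ : Finset V), ¬ ((outNbrs (cubeGraph ω) {u} ∅).card : ℝ) ≤ Δ) ∨
        ∃ S ∈ F, ¬ d * S.card ≤ ((outNbrs (cubeGraph ω) S (S ∪ T)).card : ℝ)) := by
        refine bernProb_mono h0 h1 fun ω hω => ?_
        by_contra! hcon
        exact hω ⟨fun u => hcon.1 u (Finset.mem_univ u), fun S hS hs =>
          hcon.2 S (Finset.mem_filter.2 ⟨Finset.mem_univ _, hS, hs⟩)⟩
    _ ≤ ∑ _u : V, exp ((Fintype.card V - 1) * (p * (exp t - 1)) - t * Δ)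
        + ∑ S ∈ F, exp (-κ) ^ S.card := by
        refine (bernProb_or_le h0 h1 _ _).trans (add_le_add ?_ ?_)
        · exact (bernProb_exists_le h0 h1 _ _).trans
            (Finset.sum_le_sum fun u _ => bernProb_degree_gt_le h0 h1 u ht)
        · refine (bernProb_exists_le h0 h1 _ _).trans (Finset.sum_le_sum fun S hSF => ?_)
          refine (bernProb_outNbrs_lt_le h0 h1 S T ht).trans ?_
          rw [← exp_nat_mul, exp_le_exp]
          obtain ⟨-, hne, hs⟩ := Finset.mem_filter.1 hSF
          exact hS S hne hs
    _ ≤ _ := by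
        rw [Finset.sum_const, nsmul_eq_mul, Finset.card_univ]
        gcongr
        have h2 : ∑ S ∈ F, exp (-κ) ^ S.card ≤
            ∑ S ∈ (Finset.univ : Finset V).powerset.erase ∅, exp (-κ) ^ S.card := by
          refine Finset.sum_le_sum_of_subset_of_nonneg (fun S hS => ?_) fun _ _ _ => by positivity
          have := (Finset.mem_filter.1 hS).2.1
          simp [this.ne_empty]
        have h3 : ∑ S ∈ (Finset.univ : Finset V).powerset, exp (-κ) ^ S.card
            = (exp (-κ) + 1) ^ Fintype.card V := by
          have := Finset.sum_pow_mul_eq_add_pow (exp (-κ)) 1 (Finset.univ : Finset V)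
          simpa [Finset.card_univ] using this
        rw [← Finset.sum_erase_add _ _ (Finset.empty_mem_powerset _)] at h3
        have h4 : (exp (-κ) + 1) ^ Fintype.card V ≤ exp (Fintype.card V * exp (-κ)) := by
          rw [exp_nat_mul]
          gcongr
          exact add_one_le_exp _
        simp only [Finset.card_empty, pow_zero] at h3
        linarith

/-- The probability that a vertex avoids `S` and is adjacent to all sets `B u`. -/
theorem le_bernProb_avoid_and_hit {κ : Type*} (h0 : 0 ≤ p) (h1 : p ≤ 1) (v : V) (S : Finset V)
    (Q : Finset κ) (B : κ → Finset V) (hB : ∀ u ∈ Q, Disjoint S (B u)) :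
    (1 - p) ^ S.card * ∏ u ∈ Q, (1 - (1 - p) ^ (B u).card) ≤
      bernProb p fun ω : Sym2 V → Bool =>
        (∀ w ∈ S, ω s(v, w) = false) ∧ ∀ u ∈ Q, ∃ w ∈ B u, ω s(v, w) = true := by
  classical
  have hinj : Function.Injective fun w : V => s(v, w) := fun a b h => Sym2.congr_right.1 h
  let I : Finset V → Finset (Sym2 V) := fun A => A.image fun w => s(v, w)
  have hI : ∀ A, (I A).card = A.card := fun A => Finset.card_image_of_injective _ hinj
  let f : (Sym2 V → Bool) → ℝ := fun ω => if ∀ e ∈ I S, ω e = false then 1 else 0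
  let g : κ → (Sym2 V → Bool) → ℝ := fun u ω => if ∃ e ∈ I (B u), ω e = true then 1 else 0
  have hf : bernExp p f = (1 - p) ^ S.card := by
    rw [← hI, ← bernProb_forall_false]; unfold bernProb; congr 1; funext ω; simp only [f]; congr
  have hg : ∀ u, bernExp p (g u) = 1 - (1 - p) ^ (B u).card := by
    intro u
    rw [← hI, ← bernProb_exists_true]; unfold bernProb; congr 1; funext ω; simp only [g]; congr
  have hharris := prod_bernExp_le h0 h1 Q g (fun u ω => by dsimp only [g]; split_ifs <;> norm_num)
    (fun u x y hxy => by
      dsimp only [g]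
      split_ifs with h h'
      · exact le_rfl
      · obtain ⟨e, he, hx⟩ := h
        exact absurd ⟨e, he, Bool.eq_true_of_true_le (hx ▸ hxy e)⟩ h'
      · norm_num
      · exact le_rfl)
  simp only [hg] at hharris
  calc _ ≤ bernExp p f * bernExp p (fun ω => ∏ u ∈ Q, g u ω) := by
        rw [hf]
        exact mul_le_mul_of_nonneg_left hharris (pow_nonneg (by linarith) _)
    _ = bernExp p (fun ω => f ω * ∏ u ∈ Q, g u ω) := by
        refine (bernExp_mul_of_disjoint (I := I S) (J := I (Q.biUnion B)) ?_ ?_ ?_).symm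
        · rw [Finset.disjoint_image hinj, Finset.disjoint_biUnion_right]
          exact hB
        · intro x y hxy
          have : (∀ e ∈ I S, x e = false) ↔ ∀ e ∈ I S, y e = false :=
            forall₂_congr fun e he => by rw [hxy e he]
          simp only [f, this]
        · intro x y hxy
          refine Finset.prod_congr rfl fun u hu => ?_
          have : (∃ e ∈ I (B u), x e = true) ↔ ∃ e ∈ I (B u), y e = true := by
            refine exists_congr fun e => and_congr_right fun he => ?_
            rw [hxy e (Finset.mem_coe.2 (Finset.image_subset_image
              (Finset.subset_biUnion_of_mem B hu) he))]
          simp only [g, this]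
    _ ≤ _ := by
        refine bernExp_mono h0 h1 fun ω => ?_
        have hfI : (∀ e ∈ I S, ω e = false) ↔ ∀ w ∈ S, ω s(v, w) = false := by simp [I]
        have hgI : ∀ u, (∃ e ∈ I (B u), ω e = true) ↔ ∃ w ∈ B u, ω s(v, w) = true := by
          intro u; simp [I]
        simp only [f, g, hfI, hgI]
        by_cases hS : ∀ w ∈ S, ω s(v, w) = false
        · by_cases hQ : ∀ u ∈ Q, ∃ w ∈ B u, ω s(v, w) = true
          · rw [if_pos hS, if_pos ⟨hS, hQ⟩, one_mul]
            exact (Finset.prod_eq_one fun u hu => if_pos (hQ u hu)).le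
          · have h2 := hQ
            push Not at h2
            obtain ⟨u, hu, h3⟩ := h2
            rw [Finset.prod_eq_zero hu, mul_zero]
            · split_ifs <;> norm_num
            · rw [if_neg]
              push Not
              exact h3
        · rw [if_neg hS, zero_mul]
          split_ifs <;> norm_num

end RandomGraph

section Resampling

variable {V : Type*} [Fintype V] [DecidableEq V] {T₀ R : Finset V} {l : ℕ} {G G' : SimpleGraph V}

/-- The pairs between the vertices of `T₀` at distance more than `l` from `R`, and the vertices
outside `T₀` at distance at least `l` from `R`. -/
noncomputable def crossPairs (T₀ R : Finset V) (l : ℕ) (G : SimpleGraph V) : Finset (Sym2 V) :=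
  ((T₀ \ ballLT G R (l + 1)) ×ˢ ((T₀ \ ballLT G R (l + 1)) ∪ ballLT G R l)ᶜ).image
    fun x => s(x.1, x.2)

theorem mem_crossPairs {x w : V} : s(x, w) ∈ crossPairs T₀ R l G ↔
    (x ∈ T₀ \ ballLT G R (l + 1) ∧ w ∉ (T₀ \ ballLT G R (l + 1)) ∪ ballLT G R l) ∨
    (w ∈ T₀ \ ballLT G R (l + 1) ∧ x ∉ (T₀ \ ballLT G R (l + 1)) ∪ ballLT G R l) := by
  simp only [crossPairs, Finset.mem_image, Finset.mem_product, Finset.mem_compl, Prod.exists,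
    Sym2.eq_iff]
  constructor
  · rintro ⟨a, b, ⟨ha, hb⟩, ⟨rfl, rfl⟩ | ⟨rfl, rfl⟩⟩
    · exact Or.inl ⟨ha, hb⟩
    · exact Or.inr ⟨ha, hb⟩
  · rintro (⟨ha, hb⟩ | ⟨ha, hb⟩)
    · exact ⟨_, _, ⟨ha, hb⟩, Or.inl ⟨rfl, rfl⟩⟩
    · exact ⟨_, _, ⟨ha, hb⟩, Or.inr ⟨rfl, rfl⟩⟩

theorem not_mem_crossPairs_of_mem_ballLT {x : V} (hx : x ∈ ballLT G R l) (w : V) :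
    s(x, w) ∉ crossPairs T₀ R l G := by
  have hx' := ballLT_mono (Nat.le_succ l) hx
  simp only [Nat.succ_eq_add_one] at hx'
  simp [mem_crossPairs, hx, hx']

theorem ballLT_eq_of_agree (h : ∀ x w, s(x, w) ∉ crossPairs T₀ R l G → (G.Adj x w ↔ G'.Adj x w))
    {R' : Finset V} (hR' : R' ⊆ R) {k : ℕ} (hk : k ≤ l + 1) : ballLT G' R' k = ballLT G R' k :=
  ballLT_congr (fun x hx w => h x w <|
    not_mem_crossPairs_of_mem_ballLT (ballLT_subset hR' l hx) w) hk

theorem freeBall_eq_of_agree (h : ∀ x w, s(x, w) ∉ crossPairs T₀ R l G → (G.Adj x w ↔ G'.Adj x w))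
    {u : V} (hu : u ∈ R) : freeBall G' T₀ R (l + 1) u = freeBall G T₀ R (l + 1) u := by
  have hu' : ({u} : Finset V) ⊆ R := by simpa using hu
  unfold freeBall
  rw [ballLT_eq_of_agree h subset_rfl le_rfl, ballLT_succ (j := l + 1) (by omega),
    ballLT_succ (j := l + 1) (by omega),
    ballLT_eq_of_agree h hu' le_rfl]
  ext w
  simp only [Finset.mem_sdiff, Finset.mem_union, mem_outNbrs, Finset.notMem_empty,
    not_false_eq_true, true_and, and_congr_left_iff, not_or]
  rintro ⟨hw, -⟩
  refine or_congr_right (exists_congr fun x => and_congr_right fun hx => (h x w ?_).symm)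
  have hx' := ballLT_subset hu' (l + 1) hx
  simp [mem_crossPairs, hx', hw]

theorem crossPairs_eq_of_agree
    (h : ∀ x w, s(x, w) ∉ crossPairs T₀ R l G → (G.Adj x w ↔ G'.Adj x w)) :
    crossPairs T₀ R l G' = crossPairs T₀ R l G := by
  rw [crossPairs, ballLT_eq_of_agree h subset_rfl le_rfl,
    ballLT_eq_of_agree h subset_rfl (Nat.le_succ l), crossPairs]

/-- The vertices of `R` with at least `a` vertices in their free ball. -/
noncomputable def largeBallSet (a : ℝ) (T₀ R : Finset V) (l : ℕ) (G : SimpleGraph V) : Finset V :=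
  R.filter fun u => a ≤ (freeBall G T₀ R (l + 1) u).card

theorem largeBallSet_eq_of_agree
    (h : ∀ x w, s(x, w) ∉ crossPairs T₀ R l G → (G.Adj x w ↔ G'.Adj x w)) (a : ℝ) :
    largeBallSet a T₀ R l G' = largeBallSet a T₀ R l G :=
  Finset.filter_congr fun u hu => by rw [freeBall_eq_of_agree h hu]

open scoped Classical in
/-- The vertices of `T₀` at distance exactly `l + 2` from every vertex of `largeBallSet`. -/
noncomputable def equidistantSet (a : ℝ) (T₀ R : Finset V) (l : ℕ) (G : SimpleGraph V) :
    Finset V :=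
  (T₀ \ ballLT G R (l + 1)).filter fun v =>
    (∀ w ∈ ballLT G R (l + 1) \ ballLT G R l, ¬ G.Adj v w) ∧
      ∀ u ∈ largeBallSet a T₀ R l G, ∃ w ∈ freeBall G T₀ R (l + 1) u, G.Adj v w

theorem mem_largeBallSet {a : ℝ} {u : V} : u ∈ largeBallSet a T₀ R l G ↔
    u ∈ R ∧ a ≤ (freeBall G T₀ R (l + 1) u).card := by
  simp only [largeBallSet, Finset.mem_filter]

theorem mem_equidistantSet {a : ℝ} {v : V} : v ∈ equidistantSet a T₀ R l G ↔
    v ∈ T₀ \ ballLT G R (l + 1) ∧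
    (∀ w ∈ ballLT G R (l + 1) \ ballLT G R l, ¬ G.Adj v w) ∧
      ∀ u ∈ largeBallSet a T₀ R l G, ∃ w ∈ freeBall G T₀ R (l + 1) u, G.Adj v w := by
  simp only [equidistantSet, Finset.mem_filter]

theorem card_equidistantSet_le_of_resolves {a : ℝ} (hQ : (largeBallSet a T₀ R l G).Nonempty)
    (hR : Resolves G (R : Set V)) :
    (equidistantSet a T₀ R l G).card
      ≤ (2 * (l + 2) + 1) ^ (R \ largeBallSet a T₀ R l G).card := by
  classical
  by_contra! hcon
  refine not_resolves_of_card_lt (fun u hu => (mem_largeBallSet.1 hu).1) hQ ?_ ?_ hcon hR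
  · intro v hv hv'
    rw [mem_equidistantSet, Finset.mem_sdiff] at hv
    obtain ⟨⟨-, hvU⟩, hvN, -⟩ := hv
    rw [ballLT_succ (j := l + 1) (by omega), Finset.mem_union, mem_outNbrs] at hv'
    rcases hv' with hv' | ⟨-, x, hx, hxv⟩
    · exact hvU hv'
    · by_cases hxl : x ∈ ballLT G R l
      · exact hvU (mem_ballLT_succ_of_adj hxl hxv)
      · exact hvN x (Finset.mem_sdiff.2 ⟨hx, hxl⟩) hxv.symm
  · intro v hv u hu
    obtain ⟨w, hw, hvw⟩ := (mem_equidistantSet.1 hv).2.2 u hu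
    exact mem_ballLT_succ_of_adj (Finset.mem_sdiff.1 hw).1 hvw.symm

/-- The configurations of `R` for which many vertices of `T₀` are likely to be unresolved. -/
structure Favourable (p a t q : ℝ) (M : ℕ) (T₀ R : Finset V) (l : ℕ) (G : SimpleGraph V) :
    Prop where
  le_card : t ≤ (T₀ \ ballLT G R (l + 1)).card
  le_prod : q ≤ (1 - p) ^ (ballLT G R (l + 1)).card *
    ∏ u ∈ largeBallSet a T₀ R l G, (1 - (1 - p) ^ (freeBall G T₀ R (l + 1) u).card)
  card_le : (R \ largeBallSet a T₀ R l G).card ≤ M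
  nonempty : (largeBallSet a T₀ R l G).Nonempty

variable {p a t q : ℝ} {M : ℕ}

theorem Favourable.of_agree (hF : Favourable p a t q M T₀ R l G')
    (h : ∀ x w, s(x, w) ∉ crossPairs T₀ R l G → (G.Adj x w ↔ G'.Adj x w)) :
    Favourable p a t q M T₀ R l G := by
  have hU := ballLT_eq_of_agree h subset_rfl le_rfl
  have hQ := largeBallSet_eq_of_agree h a
  obtain ⟨h1, h2, h3, h4⟩ := hF
  rw [hU] at h1 h2
  rw [hQ] at h2 h3 h4
  refine ⟨h1, ?_, h3, h4⟩
  rwa [Finset.prod_congr rfl fun u hu => by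
    rw [freeBall_eq_of_agree h (mem_largeBallSet.1 hu).1]] at h2

theorem Favourable.bernProb_card_equidistantSet_le {ω : Sym2 V → Bool} (h0 : 0 ≤ p) (h1 : p ≤ 1)
    (hq : 0 ≤ q) (hF : Favourable p a t q M T₀ R l (cubeGraph ω)) (K : ℝ) :
    bernProb p (fun ω' => ((equidistantSet a T₀ R l (cubeGraph
      ((crossPairs T₀ R l (cubeGraph ω)).piecewise ω' ω))).card : ℝ) ≤ K)
      ≤ exp (log 2 * K - t * q / 2) := by
  classical
  set G := cubeGraph ω with hG
  set U := ballLT G R (l + 1) with hU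
  set U₀ := ballLT G R l with hU₀
  set T := T₀ \ U with hT
  set Q := largeBallSet a T₀ R l G with hQdef
  have hU₀U : U₀ ⊆ U := ballLT_mono (Nat.le_succ l)
  have hagree : ∀ ω' x w, s(x, w) ∉ crossPairs T₀ R l G →
      (G.Adj x w ↔ (cubeGraph ((crossPairs T₀ R l G).piecewise ω' ω)).Adj x w) := by
    intro ω' x w hxw
    simp only [hG, cubeGraph_adj]
    rw [Finset.piecewise_eq_of_notMem _ _ _ hxw]
  let A : V → (Sym2 V → Bool) → Prop := fun v ω' =>
    (∀ w ∈ U \ U₀, ω' s(v, w) = false) ∧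
      ∀ u ∈ Q, ∃ w ∈ freeBall G T₀ R (l + 1) u, ω' s(v, w) = true
  have hS : ∀ w ∈ U \ U₀, w ∉ T ∪ U₀ := by
    intro w hw
    simp only [hT, Finset.mem_sdiff, Finset.mem_union] at hw ⊢
    tauto
  have hB : ∀ u, ∀ w ∈ freeBall G T₀ R (l + 1) u, w ∉ T ∪ U₀ := by
    intro u w hw
    simp only [hT, freeBall, Finset.mem_sdiff, Finset.mem_union, not_or] at hw ⊢
    exact ⟨fun h => hw.2.1 h.1, fun h => hw.2.2 (hU₀U h)⟩
  have hadj : ∀ ω' v w, v ∈ T → w ∉ T ∪ U₀ →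
      ((cubeGraph ((crossPairs T₀ R l G).piecewise ω' ω)).Adj v w ↔ ω' s(v, w) = true) := by
    intro ω' v w hv hw
    rw [cubeGraph_adj, Finset.piecewise_eq_of_mem _ _ _ (mem_crossPairs.2 (Or.inl ⟨hv, hw⟩)),
      and_iff_left]
    rintro rfl
    exact hw (Finset.mem_union_left _ hv)
  have hset : ∀ ω', equidistantSet a T₀ R l (cubeGraph ((crossPairs T₀ R l G).piecewise ω' ω))
      = T.filter fun v => A v ω' := by
    intro ω'
    ext v
    rw [mem_equidistantSet, Finset.mem_filter, ballLT_eq_of_agree (hagree ω') subset_rfl le_rfl,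
      ballLT_eq_of_agree (hagree ω') subset_rfl (Nat.le_succ l),
      largeBallSet_eq_of_agree (hagree ω')]
    refine and_congr_right fun hv => ?_
    refine and_congr (forall₂_congr fun w hw => ?_) (forall₂_congr fun u hu => ?_)
    · rw [hadj ω' v w hv (hS w hw), Bool.not_eq_true]
    · rw [freeBall_eq_of_agree (hagree ω') (mem_largeBallSet.1 hu).1]
      exact exists_congr fun w => and_congr_right fun hw => hadj ω' v w hv (hB u w hw)
  let J : V → Finset (Sym2 V) := fun v => (T ∪ U₀)ᶜ.image fun w => s(v, w)
  simp only [hset]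
  have hp' : (0 : ℝ) ≤ 1 - p := by linarith
  refine (bernProb_card_le h0 h1 T J ?_ A ?_ (q := q) ?_ (log_nonneg one_le_two)).trans ?_
  · intro v hv w hw hvw
    rw [Finset.disjoint_left]
    intro e he he'
    obtain ⟨x, hx, rfl⟩ := Finset.mem_image.1 he
    obtain ⟨y, hy, hxy⟩ := Finset.mem_image.1 he'
    simp only [Sym2.eq_iff] at hxy
    rcases hxy with ⟨h, -⟩ | ⟨rfl, -⟩
    · exact hvw h.symm
    · exact Finset.mem_compl.1 hx (Finset.mem_union_left _ hw)
  · intro v _ x y hxy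
    have hval : ∀ w, w ∉ T ∪ U₀ → x s(v, w) = y s(v, w) := fun w hw =>
      hxy _ (Finset.mem_coe.2 (Finset.mem_image_of_mem _ (Finset.mem_compl.2 hw)))
    refine propext (and_congr (forall₂_congr fun w hw => ?_) (forall₂_congr fun u _ =>
      exists_congr fun w => and_congr_right fun hw => ?_))
    · rw [hval w (hS w hw)]
    · rw [hval w (hB u w hw)]
  · intro v _
    refine le_trans (hF.le_prod.trans ?_) (le_bernProb_avoid_and_hit h0 h1 v (U \ U₀) Q
      (freeBall G T₀ R (l + 1)) ?_)
    · refine mul_le_mul_of_nonneg_right (pow_le_pow_of_le_one hp' (by linarith)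
        (Finset.card_le_card Finset.sdiff_subset)) (Finset.prod_nonneg fun u _ => ?_)
      have := pow_le_one₀ (n := (freeBall G T₀ R (l + 1) u).card) hp' (by linarith)
      linarith
    · intro u _
      refine Finset.disjoint_left.2 fun w hw hw' => ?_
      exact (Finset.mem_sdiff.1 hw').2 (Finset.mem_union_right _ (Finset.mem_sdiff.1 hw).1)
  · rw [exp_le_exp, exp_neg, exp_log two_pos]
    have := mul_le_mul_of_nonneg_right hF.le_card hq
    linarith

/-- A fixed set is unlikely to be both favourable and resolving. -/
theorem bernProb_favourable_and_resolves_le (h0 : 0 ≤ p) (h1 : p ≤ 1) (hq : 0 ≤ q) :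
    bernProb p (fun ω => Favourable p a t q M T₀ R l (cubeGraph ω) ∧
      Resolves (cubeGraph ω) (R : Set V))
      ≤ exp (log 2 * (2 * (l + 2) + 1) ^ M - t * q / 2) := by
  classical
  set K : ℝ := (2 * (l + 2) + 1) ^ M
  set J : (Sym2 V → Bool) → Finset (Sym2 V) := fun ω => crossPairs T₀ R l (cubeGraph ω) with hJ
  have hagree : ∀ ω ω' x w, s(x, w) ∉ J ω →
      ((cubeGraph ω).Adj x w ↔ (cubeGraph ((J ω).piecewise ω' ω)).Adj x w) := by
    intro ω ω' x w hxw
    simp only [cubeGraph_adj]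
    rw [Finset.piecewise_eq_of_notMem _ _ _ hxw]
  calc bernProb p (fun ω => Favourable p a t q M T₀ R l (cubeGraph ω) ∧
      Resolves (cubeGraph ω) (R : Set V))
      ≤ bernProb p (fun ω => Favourable p a t q M T₀ R l (cubeGraph ω) ∧
        ((equidistantSet a T₀ R l (cubeGraph ω)).card : ℝ) ≤ K) := by
        refine bernProb_mono h0 h1 fun ω hω => ⟨hω.1, ?_⟩
        have h2 := (card_equidistantSet_le_of_resolves hω.1.nonempty hω.2).trans
          (Nat.pow_le_pow_right (by omega) hω.1.card_le)
        simp only [K]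
        exact_mod_cast h2
    _ ≤ bernExp p fun _ => exp (log 2 * K - t * q / 2) := by
        rw [bernProb, ← bernExp_resample J fun ω ω' => crossPairs_eq_of_agree (hagree ω ω')]
        refine bernExp_mono h0 h1 fun ω => ?_
        by_cases hF : Favourable p a t q M T₀ R l (cubeGraph ω)
        · refine le_trans ?_ (hF.bernProb_card_equidistantSet_le h0 h1 hq K)
          refine bernExp_mono h0 h1 fun ω' => ?_
          split_ifs with h2 h3
          · exact le_rfl
          · exact absurd h2.2 h3
          · exact zero_le_one
          · exact le_rfl
        · have : ∀ ω', ¬ Favourable p a t q M T₀ R l (cubeGraph ((J ω).piecewise ω' ω)) :=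
            fun ω' h => hF (h.of_agree (hagree ω ω'))
          simp only [this, false_and, if_false, bernExp_const]
          positivity
    _ = _ := bernExp_const _

end Resampling

section FiniteBounds

variable {V : Type*} [Fintype V] [DecidableEq V] {p : ℝ}

theorem exp_neg_le_quadratic {x : ℝ} (hx : 0 ≤ x) : exp (-x) ≤ 1 - x + x ^ 2 / 2 := by
  have h1 := quadratic_le_exp_of_nonneg hx
  have h2 : 0 ≤ 1 - x + x ^ 2 / 2 := by nlinarith [sq_nonneg (x - 1)]
  have h3 : 1 ≤ exp x * (1 - x + x ^ 2 / 2) := by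
    nlinarith [mul_le_mul_of_nonneg_right h1 h2, sq_nonneg (x ^ 2)]
  calc exp (-x) ≤ exp (-x) * (exp x * (1 - x + x ^ 2 / 2)) :=
        le_mul_of_one_le_right (exp_pos _).le h3
    _ = _ := by rw [← mul_assoc, ← exp_add]; simp

theorem bernProb_not_expands_le_exp (h0 : 0 ≤ p) (h1 : p ≤ 1) {ε s : ℝ} (hε : 0 < ε) (hε1 : ε ≤ 1)
    {T : Finset V} (hT : (T.card : ℝ) ≤ ε / 16 * Fintype.card V)
    (hs : s ≤ ε / 16 * Fintype.card V) (hps : p * s ≤ ε / 4)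
    {d : ℝ} (hd : d = p * (Fintype.card V - 1)) :
    bernProb p (fun ω => ¬ Expands (V := V) (cubeGraph ω) T ((1 + ε) * d) ((1 - ε) * d) s) ≤
      Fintype.card V * exp (-(ε ^ 2 * d / 4))
        + (exp (Fintype.card V * exp (-(ε ^ 2 * d / 4))) - 1) := by
  rcases Nat.eq_zero_or_pos (Fintype.card V) with hV0 | hV
  · have := Fintype.card_eq_zero_iff.1 hV0
    refine le_trans (bernProb_not_expands_le (t := 0) (κ := 0) h0 h1 T le_rfl fun S hS => ?_) ?_
    · exact (IsEmpty.false hS.choose).elim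
    · simp
  have hV' : (1 : ℝ) ≤ Fintype.card V := by exact_mod_cast hV
  have hd0 : 0 ≤ d := hd ▸ mul_nonneg h0 (by linarith)
  refine (bernProb_not_expands_le (t := ε / 2) (κ := ε ^ 2 * d / 4) h0 h1 T (by linarith) ?_).trans
    (add_le_add_left (mul_le_mul_of_nonneg_left (exp_le_exp.2 ?_) (Nat.cast_nonneg _)) _)
  · intro S hS hSs
    set x : ℝ := (S.card : ℝ)
    have hx0 : 0 ≤ x := Nat.cast_nonneg _
    have hcompl : (1 - ε / 8) * (Fintype.card V : ℝ) ≤ ((S ∪ T)ᶜ.card : ℝ) := by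
      have h2 := Finset.card_union_le S T
      have h3 := Finset.card_add_card_compl (S ∪ T)
      have h2' : ((S ∪ T).card : ℝ) ≤ S.card + T.card := by exact_mod_cast h2
      have h3' : ((S ∪ T).card : ℝ) + ((S ∪ T)ᶜ.card : ℝ) = Fintype.card V := by exact_mod_cast h3
      linarith
    have hpx : p * x ≤ ε / 4 := (mul_le_mul_of_nonneg_left hSs h0).trans hps
    have hpx0 : 0 ≤ p * x := mul_nonneg h0 hx0
    have hpow : p * x * (1 - ε / 8) ≤ 1 - (1 - p) ^ S.card := by
      have h2 : (1 - p) ^ S.card ≤ exp (-(p * x)) := by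
        have : exp (-(p * x)) = exp (-p) ^ S.card := by
          rw [← exp_nat_mul]; congr 1; ring
        rw [this]
        exact pow_le_pow_left₀ (by linarith) (one_sub_le_exp_neg p) _
      have h3 : exp (-(p * x)) ≤ 1 - p * x + (p * x) ^ 2 / 2 := exp_neg_le_quadratic hpx0
      nlinarith
    have hexp : ε / 2 * (1 - ε / 4) ≤ 1 - exp (-(ε / 2)) := by
      have h3 : exp (-(ε / 2)) ≤ 1 - ε / 2 + (ε / 2) ^ 2 / 2 := exp_neg_le_quadratic (by linarith)
      nlinarith
    have hdV : d * x ≤ Fintype.card V * (p * x) := by rw [hd]; nlinarith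
    have h2 : (1 - ε / 8) * (Fintype.card V : ℝ) * (p * x * (1 - ε / 8) * (ε / 2 * (1 - ε / 4))) ≤
        ((S ∪ T)ᶜ.card : ℝ) * ((1 - (1 - p) ^ S.card) * (1 - exp (-(ε / 2)))) := by
      have h5 : 0 ≤ 1 - ε / 4 := by linarith
      have h6 : 0 ≤ 1 - ε / 8 := by linarith
      have h7 : 0 ≤ ε / 2 * (1 - ε / 4) := mul_nonneg (by linarith) h5
      have h8 : 0 ≤ p * x * (1 - ε / 8) := mul_nonneg hpx0 h6
      exact mul_le_mul hcompl (mul_le_mul hpow hexp h7 (h8.trans hpow)) (mul_nonneg h8 h7)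
        (Nat.cast_nonneg _)
    have h3 : (1 - ε / 2) ≤ (1 - ε / 8) * ((1 - ε / 8) * (1 - ε / 4)) := by
      have h5 : 0 ≤ 5 / 64 - ε / 256 := by linarith
      nlinarith [mul_nonneg (sq_nonneg ε) h5]
    have h4 : d * x * (ε / 2) * (1 - ε / 2) ≤
        (1 - ε / 8) * (Fintype.card V : ℝ) * (p * x * (1 - ε / 8) * (ε / 2 * (1 - ε / 4))) := by
      have h5 : 0 ≤ d * x * (ε / 2) := by positivity
      have h6 : 0 ≤ 1 - ε / 2 := by linarith
      calc d * x * (ε / 2) * (1 - ε / 2)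
          ≤ Fintype.card V * (p * x) * (ε / 2) * ((1 - ε / 8) * ((1 - ε / 8) * (1 - ε / 4))) := by
            gcongr
        _ = _ := by ring
    nlinarith
  · have h2 : exp (ε / 2) ≤ 1 + ε / 2 + (ε / 2) ^ 2 := by
      have := abs_exp_sub_one_sub_id_le (x := ε / 2) (by rw [abs_of_pos] <;> linarith)
      have := (abs_le.1 this).2
      linarith
    have h3 : ((Fintype.card V : ℝ) - 1) * (p * (exp (ε / 2) - 1)) = d * (exp (ε / 2) - 1) := by
      rw [hd]; ring
    rw [h3]
    nlinarith

theorem prod_one_sub_ge_exp {κ : Type*} (Q : Finset κ) {y : κ → ℝ} {η : ℝ}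
    (hy : ∀ u ∈ Q, exp (-((1 + η) * y u)) ≤ 1 - y u) :
    exp (-((1 + η) * ∑ u ∈ Q, y u)) ≤ ∏ u ∈ Q, (1 - y u) := by
  rw [Finset.mul_sum, ← Finset.sum_neg_distrib, exp_sum]
  exact Finset.prod_le_prod (fun _ _ => (exp_pos _).le) hy

/-- In an expanding graph every small set of vertices is favourable. -/
theorem Expands.favourable {G : SimpleGraph V} {T : Finset V} {Δ d η θ y₀ : ℝ} {l M m k : ℕ}
    (h : Expands G T Δ d (2 * (1 + Δ) ^ l)) (h0 : 0 ≤ p) (h1 : p ≤ 1)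
    (hd : 0 ≤ d) (hdΔ : d ≤ 1 + Δ) (hΔ : 0 ≤ Δ) (hη : 0 ≤ η)
    (hM : k * (1 + Δ) ^ l
      < M * (1 / 2 * d ^ (l + 1) - M * ((1 + Δ) ^ (l + 1) - d ^ (l + 1))))
    (hm : k * (1 + Δ) ^ l
      < m * (θ * d ^ (l + 1) - m * ((1 + Δ) ^ (l + 1) - d ^ (l + 1))))
    (hMk : M < k) (hy₀ : ∀ y, 0 ≤ y → y ≤ y₀ → exp (-((1 + η) * y)) ≤ 1 - y) (hpy : p ≤ y₀)
    (hDy : exp (-(p * (1 / 2 * d ^ (l + 1)))) ≤ y₀) {R : Finset V} (hR : R.card = k) :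
    Favourable p (1 / 2 * d ^ (l + 1)) (T.card - k * (1 + Δ) ^ l)
      (exp (-((1 + η) * (p * (k * (1 + Δ) ^ l) + (k * exp (-(p * ((1 - θ) * d ^ (l + 1))))
        + m * exp (-(p * (1 / 2 * d ^ (l + 1)))))))))
      M T R l G := by
  classical
  set D := d ^ (l + 1)
  set Q := largeBallSet (1 / 2 * D) T R l G with hQ
  have hU : ((ballLT G R (l + 1)).card : ℝ) ≤ k * (1 + Δ) ^ l := by
    rw [← hR]; exact h.card_ballLT_le hΔ R l
  have hQR : Q ⊆ R := fun u hu => (mem_largeBallSet.1 hu).1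
  have hcardM : (R \ Q).card ≤ M := by
    have h2 := h.card_filter_freeBall_lt hd hdΔ hΔ R (m := M) (θ := 1 / 2) (by rw [hR]; exact hM)
    refine (Finset.card_le_card fun u hu => ?_).trans h2.le
    rw [Finset.mem_sdiff, hQ, mem_largeBallSet, not_and, not_le] at hu
    rw [Finset.mem_filter]
    refine ⟨hu.1, (hu.2 hu.1).trans_le (le_of_eq ?_)⟩
    simp only [D]; ring
  have hcardm := h.card_filter_freeBall_lt hd hdΔ hΔ R (m := m) (θ := θ) (by rw [hR]; exact hm)
  have hpowle : ∀ j : ℕ, (1 - p) ^ j ≤ exp (-(p * j)) := by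
    intro j
    have : exp (-(p * j)) = exp (-p) ^ j := by rw [← exp_nat_mul]; ring_nf
    rw [this]
    exact pow_le_pow_left₀ (by linarith) (one_sub_le_exp_neg p) _
  refine ⟨?_, ?_, hcardM, ?_⟩
  · have h2 := Finset.le_card_sdiff (ballLT G R (l + 1)) T
    have h3 : T.card ≤ (T \ ballLT G R (l + 1)).card + (ballLT G R (l + 1)).card := by omega
    have h3' : (T.card : ℝ) ≤ (T \ ballLT G R (l + 1)).card + (ballLT G R (l + 1)).card := by
      exact_mod_cast h3
    linarith
  · have hsum : ∑ u ∈ Q, (1 - p) ^ (freeBall G T R (l + 1) u).card ≤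
        k * exp (-(p * ((1 - θ) * D))) + m * exp (-(p * (1 / 2 * D))) := by
      have hpt : ∀ u ∈ Q, (1 - p) ^ (freeBall G T R (l + 1) u).card ≤
          exp (-(p * ((1 - θ) * D))) +
          if ((freeBall G T R (l + 1) u).card : ℝ) < (1 - θ) * D
            then exp (-(p * (1 / 2 * D))) else 0 := by
        intro u hu
        refine (hpowle _).trans ?_
        split_ifs with hlt
        · have : exp (-(p * (freeBall G T R (l + 1) u).card)) ≤ exp (-(p * (1 / 2 * D))) := by
            have := mul_le_mul_of_nonneg_left (mem_largeBallSet.1 hu).2 h0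
            exact exp_le_exp.2 (by linarith)
          linarith [exp_pos (-(p * ((1 - θ) * D)))]
        · have := mul_le_mul_of_nonneg_left (not_lt.1 hlt) h0
          rw [add_zero]
          exact exp_le_exp.2 (by linarith)
      refine (Finset.sum_le_sum hpt).trans ?_
      rw [Finset.sum_add_distrib, Finset.sum_const, nsmul_eq_mul, ← Finset.sum_filter,
        Finset.sum_const, nsmul_eq_mul]
      have h2 : (Q.card : ℝ) ≤ k := by rw [← hR]; exact_mod_cast Finset.card_le_card hQR
      have h3 : ((Q.filter fun u =>
          ((freeBall G T R (l + 1) u).card : ℝ) < (1 - θ) * D).card : ℝ) ≤ m := by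
        exact_mod_cast (Finset.card_le_card (Finset.filter_subset_filter _ hQR)).trans hcardm.le
      gcongr
    have hprod := prod_one_sub_ge_exp Q (η := η)
      (y := fun u => (1 - p) ^ (freeBall G T R (l + 1) u).card) fun u hu => by
        refine hy₀ _ (pow_nonneg (by linarith) _) ((hpowle _).trans (le_trans ?_ hDy))
        have := mul_le_mul_of_nonneg_left (mem_largeBallSet.1 hu).2 h0
        exact exp_le_exp.2 (by linarith)
    have hUpow : exp (-((1 + η) * (p * (k * (1 + Δ) ^ l)))) ≤
        (1 - p) ^ (ballLT G R (l + 1)).card := by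
      calc exp (-((1 + η) * (p * (k * (1 + Δ) ^ l))))
          ≤ exp (-((1 + η) * (p * (ballLT G R (l + 1)).card))) := by
            gcongr
        _ = exp (-((1 + η) * p)) ^ (ballLT G R (l + 1)).card := by
            rw [← exp_nat_mul]; ring_nf
        _ ≤ _ := pow_le_pow_left₀ (exp_pos _).le (hy₀ p h0 hpy) _
    rw [mul_add, neg_add, exp_add]
    refine mul_le_mul hUpow (le_trans ?_ hprod) (exp_pos _).le (pow_nonneg (by linarith) _)
    gcongr
  · rw [Finset.nonempty_iff_ne_empty]
    intro hempty
    rw [hQ, hempty, Finset.sdiff_empty, hR] at hcardM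
    omega

theorem one_sub_le_gnpProb_le_metricDim {n : ℕ} (h0 : 0 ≤ p) (h1 : p ≤ 1)
    {T : Finset (Fin n)} {Δ d s a t q b : ℝ} {l M k : ℕ} (hs : 1 ≤ s) (hd : 0 < d) (hq : 0 ≤ q)
    (hkn : k ≤ n) (hb : b < k + 1)
    (hfav : ∀ (G : SimpleGraph (Fin n)) (R : Finset (Fin n)), Expands G T Δ d s → R.card = k →
      Favourable p a t q M T R l G) :
    1 - (bernProb p (fun ω => ¬ Expands (V := Fin n) (cubeGraph ω) T Δ d s)
      + n ^ k * exp (log 2 * (2 * (l + 2) + 1) ^ M - t * q / 2))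
      ≤ gnpProb n p {G | b ≤ (metricDim G : ℝ)} := by
  classical
  rw [gnpProb_eq]
  have hnot := bernProb_not (p := p) fun ω : Sym2 (Fin n) → Bool =>
    cubeGraph ω ∈ {G : SimpleGraph (Fin n) | b ≤ (metricDim G : ℝ)}
  have hbad : bernProb p (fun ω : Sym2 (Fin n) → Bool =>
      ¬ cubeGraph ω ∈ {G : SimpleGraph (Fin n) | b ≤ (metricDim G : ℝ)}) ≤
      bernProb p (fun ω => ¬ Expands (V := Fin n) (cubeGraph ω) T Δ d s)
      + n ^ k * exp (log 2 * (2 * (l + 2) + 1) ^ M - t * q / 2) := by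
    refine (bernProb_mono h0 h1 (B := fun ω => ¬ Expands (V := Fin n) (cubeGraph ω) T Δ d s ∨
      ∃ R ∈ (Finset.univ : Finset (Fin n)).powersetCard k,
        Favourable p a t q M T R l (cubeGraph ω) ∧ Resolves (cubeGraph ω) (R : Set (Fin n)))
      fun ω hω => ?_).trans ((bernProb_or_le h0 h1 _ _).trans (add_le_add le_rfl
        ((bernProb_exists_le h0 h1 _ _).trans ?_)))
    · by_cases hE : Expands (V := Fin n) (cubeGraph ω) T Δ d s
      · right
        simp only [Set.mem_ofPred_eq, not_le] at hω
        have hlt : metricDim (cubeGraph ω) < k + 1 := by exact_mod_cast hω.trans hb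
        obtain ⟨R, hRk, hR⟩ := exists_resolves_of_metricDim_le (hE.resolves_univ (h_s := hs) hd)
          (Nat.lt_succ_iff.1 hlt) (by simpa using hkn)
        exact ⟨R, by simp [Finset.mem_powersetCard, hRk], hfav _ R hE hRk, hR⟩
      · exact Or.inl hE
    · refine (Finset.sum_le_sum fun R _ => bernProb_favourable_and_resolves_le h0 h1 hq).trans ?_
      rw [Finset.sum_const, nsmul_eq_mul, Finset.card_powersetCard, Finset.card_univ,
        Fintype.card_fin]
      gcongr
      exact_mod_cast Nat.choose_le_pow n k
  linarith

end FiniteBounds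

section Estimates

theorem one_add_pow_le_of_le_one {y : ℝ} (h0 : 0 ≤ y) (h1 : y ≤ 1) (m : ℕ) :
    (1 + y) ^ m ≤ 1 + (2 ^ m - 1) * y := by
  induction m with
  | zero => simp
  | succ m ih =>
    have h2 : (1 : ℝ) ≤ 2 ^ m := one_le_pow₀ one_le_two
    calc (1 + y) ^ (m + 1) = (1 + y) ^ m * (1 + y) := pow_succ _ _
      _ ≤ (1 + (2 ^ m - 1) * y) * (1 + y) := by gcongr
      _ ≤ _ := by
        rw [pow_succ]
        nlinarith [mul_nonneg (sub_nonneg.2 h2) (mul_nonneg h0 (sub_nonneg.2 h1))]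

theorem growth_pow_bounds {d ε C a : ℝ} {l : ℕ} (hε : 0 < ε) (hε1 : ε ≤ 1 / 2) (hd : 1 ≤ ε * d)
    (hC : 2 ^ (l + 2) + ((l : ℝ) + 1) ≤ C) (ha : C * ε ≤ a) :
    (1 + (1 + ε) * d) ^ l ≤ (1 + a) * d ^ l ∧
    (1 + (1 + ε) * d) ^ (l + 1) - ((1 - ε) * d) ^ (l + 1) ≤ a * d ^ (l + 1) ∧
    (1 - a) * d ^ (l + 1) ≤ ((1 - ε) * d) ^ (l + 1) := by
  have hd0 : 0 < d := by
    by_contra! h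
    nlinarith
  have h1 : 1 + (1 + ε) * d ≤ (1 + 2 * ε) * d := by linarith
  have h2 : (1 : ℝ) ≤ 2 ^ l := one_le_pow₀ one_le_two
  have hp2 : (2 : ℝ) ^ (l + 2) = 4 * 2 ^ l := by ring
  have hp1 : (2 : ℝ) ^ (l + 1) = 2 * 2 ^ l := by ring
  have hl : (0 : ℝ) ≤ l := Nat.cast_nonneg l
  have hup : ∀ m, (1 + (1 + ε) * d) ^ m ≤ (1 + (2 ^ m - 1) * (2 * ε)) * d ^ m := fun m => by
    calc (1 + (1 + ε) * d) ^ m ≤ ((1 + 2 * ε) * d) ^ m := by gcongr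
      _ = (1 + 2 * ε) ^ m * d ^ m := mul_pow _ _ _
      _ ≤ _ := by gcongr; exact one_add_pow_le_of_le_one (by linarith) (by linarith) m
  have hlow : (1 - (l + 1) * ε) * d ^ (l + 1) ≤ ((1 - ε) * d) ^ (l + 1) := by
    rw [mul_pow]
    gcongr
    have := one_add_mul_le_pow (a := -ε) (by linarith) (l + 1)
    push_cast at this
    calc 1 - ((l : ℝ) + 1) * ε = 1 + (l + 1) * -ε := by ring
      _ ≤ (1 + -ε) ^ (l + 1) := this
      _ = (1 - ε) ^ (l + 1) := by ring
  have hCε := mul_le_mul_of_nonneg_right hC hε.le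
  have hdl : 0 < d ^ l := pow_pos hd0 l
  have hdl1 : 0 < d ^ (l + 1) := pow_pos hd0 _
  refine ⟨(hup l).trans ?_, ?_, le_trans ?_ hlow⟩
  · gcongr
    nlinarith
  · have h3 := hup (l + 1)
    have h4 : (2 ^ (l + 1) - 1) * (2 * ε) + (l + 1) * ε ≤ a := by
      rw [hp1]; nlinarith
    have := mul_le_mul_of_nonneg_right h4 hdl1.le
    linarith
  · gcongr
    nlinarith

theorem mul_lt_of_bounds {k W m D D' a w A θ : ℝ} (hkW : k * W < m * (A / 4)) (hm : 0 ≤ m)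
    (hDD : D' - D ≤ a * w) (hD : A / 2 ≤ θ * D) (hma : m * (a * w) ≤ A / 4) :
    k * W < m * (θ * D - m * (D' - D)) := by
  have h1 : m * (D' - D) ≤ A / 4 := (mul_le_mul_of_nonneg_left hDD hm).trans hma
  have h2 : A / 4 ≤ θ * D - m * (D' - D) := by linarith
  exact hkW.trans_le (mul_le_mul_of_nonneg_left h2 hm)

/-- Existence of the cutoff `m` separating the slightly small free balls from the others. -/
theorem exists_cutoff {k d L a c W D D' : ℝ} {l : ℕ} (hL : 100 ≤ L) (hd : 400 * L ^ 17 ≤ d)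
    (hc : 0 ≤ c) (ha0 : 0 ≤ a) (hk0 : 0 ≤ k) (hkd : k ≤ L * d) (hkc : k ≤ L * exp c) (ha : a ≤ (L ^ 7)⁻¹)
    (hW : W ≤ 2 * d ^ l) (hDD : D' - D ≤ a * d ^ (l + 1)) (hD : 1 / 2 * d ^ (l + 1) ≤ D) :
    ∃ m : ℕ, k * W < m * ((L ^ 2)⁻¹ * D - m * (D' - D)) ∧ m * exp (-(c / 3)) ≤ 1 := by
  have hL0 : 0 < L := by linarith
  have hd0 : 0 < d := lt_of_lt_of_le (by positivity) hd
  have hdl : 0 < d ^ l := pow_pos hd0 l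
  have hdl1 : 0 < d ^ (l + 1) := pow_pos hd0 _
  have hA : (0 : ℝ) ≤ (L ^ 2)⁻¹ * d ^ (l + 1) := by positivity
  have hDA : (L ^ 2)⁻¹ * d ^ (l + 1) / 2 ≤ (L ^ 2)⁻¹ * D := by
    have := mul_le_mul_of_nonneg_left hD (inv_nonneg.2 (sq_nonneg L))
    linarith
  have hkW : k * W ≤ k * (2 * d ^ l) := mul_le_mul_of_nonneg_left hW hk0
  rcases le_total (2 * L ^ 4) (exp (c / 3)) with h | h
  · have hceil := Nat.ceil_lt_add_one (a := L ^ 4) (by positivity)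
    have hle := Nat.le_ceil (L ^ 4)
    have hL4 : 1 ≤ L ^ 4 := one_le_pow₀ (by linarith)
    refine ⟨⌈L ^ 4⌉₊, mul_lt_of_bounds (A := (L ^ 2)⁻¹ * d ^ (l + 1)) ?_ (Nat.cast_nonneg _)
      hDD hDA ?_, ?_⟩
    · calc k * W ≤ (L * d) * (2 * d ^ l) := hkW.trans (by gcongr)
        _ = 2 * L * d ^ (l + 1) := by ring
        _ < L ^ 4 * ((L ^ 2)⁻¹ * d ^ (l + 1) / 4) := by
          have : L ^ 4 * ((L ^ 2)⁻¹ * d ^ (l + 1) / 4) = L ^ 2 / 4 * d ^ (l + 1) := by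
            field_simp
          rw [this]
          gcongr
          nlinarith
        _ ≤ _ := by gcongr
    · calc (⌈L ^ 4⌉₊ : ℝ) * (a * d ^ (l + 1)) ≤ (2 * L ^ 4) * ((L ^ 7)⁻¹ * d ^ (l + 1)) := by
            gcongr; linarith
        _ = 2 / L * ((L ^ 2)⁻¹ * d ^ (l + 1)) := by field_simp
        _ ≤ 1 / 4 * ((L ^ 2)⁻¹ * d ^ (l + 1)) := by
            refine mul_le_mul_of_nonneg_right ?_ hA
            rw [div_le_div_iff₀ hL0 (by norm_num)]
            linarith
        _ = _ := by ring
    · rw [exp_neg, ← div_eq_mul_inv, div_le_one (exp_pos _)]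
      linarith
  · have hec : exp c ≤ 8 * L ^ 12 := by
      calc exp c = exp (c / 3) ^ 3 := by rw [← exp_nat_mul]; congr 1; push_cast; ring
        _ ≤ (2 * L ^ 4) ^ 3 := by gcongr
        _ = _ := by ring
    refine ⟨1, mul_lt_of_bounds (A := (L ^ 2)⁻¹ * d ^ (l + 1)) ?_ (Nat.cast_nonneg _)
      hDD hDA ?_, ?_⟩
    · have hk : k ≤ L * (8 * L ^ 12) := hkc.trans (by gcongr)
      calc k * W ≤ (L * (8 * L ^ 12)) * (2 * d ^ l) := hkW.trans (by gcongr)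
        _ = 16 * L ^ 13 * d ^ l := by ring
        _ < (400 * L ^ 17) * (L ^ 2)⁻¹ / 4 * d ^ l := by
          have : (400 * L ^ 17) * (L ^ 2)⁻¹ / 4 = 100 * L ^ 2 * L ^ 13 := by field_simp; norm_num
          rw [this]
          gcongr
          nlinarith
        _ ≤ d * (L ^ 2)⁻¹ / 4 * d ^ l := by gcongr
        _ = _ := by push_cast; ring
    · calc ((1 : ℕ) : ℝ) * (a * d ^ (l + 1)) ≤ 1 * ((L ^ 7)⁻¹ * d ^ (l + 1)) := by
            push_cast; gcongr
        _ = (L ^ 5)⁻¹ * ((L ^ 2)⁻¹ * d ^ (l + 1)) := by field_simp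
        _ ≤ 1 / 4 * ((L ^ 2)⁻¹ * d ^ (l + 1)) := by
            gcongr
            rw [inv_le_comm₀ (by positivity) (by norm_num)]
            calc (1 / 4 : ℝ)⁻¹ ≤ L := by norm_num; linarith
              _ ≤ L ^ 5 := le_self_pow₀ (by linarith) (by norm_num)
        _ = _ := by ring
    · rw [Nat.cast_one, one_mul, exp_le_one_iff]
      linarith

end Estimates

section Parameters

set_option maxHeartbeats 800000 in
theorem exponent_le {n k m l : ℕ} {p d c L η θ a α W D : ℝ} (hp : 0 ≤ p)
    (hd : d = p * ((n : ℝ) - 1))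
    (hc : c = d ^ (l + 2) / n) (hη : 0 < η) (hη1 : η ≤ 1) (hL : 100 ≤ L) (hLη : 12 ≤ η * L)
    (hnL : L ≤ (n : ℝ) - 1) (hc0 : 0 ≤ c) (hc3 : c ≤ 3 * L) (hd0 : 0 ≤ d) (ha0 : 0 ≤ a)
    (ha : a ≤ (L ^ 2)⁻¹) (hθ0 : 0 ≤ θ) (hθ : θ ≤ (L ^ 2)⁻¹) (hW : W ≤ (1 + a) * d ^ l)
    (hD : (1 - a) * d ^ (l + 1) ≤ D)
    (hk : k * (d ^ (l + 1) / n + exp (-c)) ≤ α * L) (hm : m * exp (-(c / 3)) ≤ 1) :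
    (1 + η) * (p * (k * W) + (k * exp (-(p * ((1 - θ) * D))) + m * exp (-(p * (1 / 2 * D)))))
      ≤ (1 + η) ^ 2 * (α * L) + 2 ∧ exp (-(p * (1 / 2 * D))) ≤ exp (-(c / 3)) := by
  have hn1 : (0 : ℝ) < (n : ℝ) - 1 := by linarith
  have hn : (0 : ℝ) < n := by linarith
  have hL0 : 0 < L := by linarith
  have hL2 : (L ^ 2)⁻¹ ≤ 1 / (100 * L) := by
    rw [inv_eq_one_div]
    apply one_div_le_one_div_of_le (by positivity)
    nlinarith
  have hη12 : 1 / (100 * L) ≤ η / 3 := by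
    rw [div_le_div_iff₀ (by positivity) (by norm_num)]
    nlinarith
  have hsmall : 1 / (100 * L) ≤ 1 / 6 := one_div_le_one_div_of_le (by norm_num) (by linarith)
  have hpn : d / n ≤ p := by
    rw [div_le_iff₀ hn, hd]
    nlinarith
  have hcp : c ≤ p * d ^ (l + 1) := by
    calc c = d / n * d ^ (l + 1) := by rw [hc]; ring
      _ ≤ _ := by gcongr
  have hpD : (1 - a) * c ≤ p * D := by
    calc (1 - a) * c ≤ (1 - a) * (p * d ^ (l + 1)) := by
          have : 0 ≤ 1 - a := by linarith
          gcongr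
      _ = p * ((1 - a) * d ^ (l + 1)) := by ring
      _ ≤ _ := by gcongr
  have h3 : exp (-(p * (1 / 2 * D))) ≤ exp (-(c / 3)) := by
    rw [exp_le_exp]
    nlinarith
  refine ⟨?_, h3⟩
  have hpW : p * (k * W) ≤ k * (d ^ (l + 1) / n) * (1 + η) := by
    have h4 : p ≤ d / n * (1 + η / 3) := by
      have : d / n * (1 + η / 3) = p * (((n : ℝ) - 1) * (1 + η / 3) / n) := by rw [hd]; ring
      rw [this]
      refine le_mul_of_one_le_right hp ?_
      rw [le_div_iff₀ hn]
      nlinarith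
    calc p * (k * W) ≤ (d / n * (1 + η / 3)) * (k * ((1 + η / 3) * d ^ l)) := by
          have : W ≤ (1 + η / 3) * d ^ l := hW.trans (by gcongr; linarith)
          calc p * (k * W) ≤ p * (k * ((1 + η / 3) * d ^ l)) := by gcongr
            _ ≤ _ := by gcongr
      _ = k * (d ^ (l + 1) / n) * (1 + η / 3) ^ 2 := by ring
      _ ≤ _ := by
        gcongr
        nlinarith
  have hpθ : exp (-(p * ((1 - θ) * D))) ≤ exp (-c) * (1 + η) := by
    have h4 : c - 6 / L ≤ p * ((1 - θ) * D) := by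
      have h5 : 0 ≤ 1 - θ := by linarith
      have h6 : (1 - θ) * ((1 - a) * c) ≤ (1 - θ) * (p * D) := by gcongr
      have h7 : (θ + a) * c ≤ 2 * (L ^ 2)⁻¹ * (3 * L) := by gcongr; linarith
      have h8 : 2 * (L ^ 2)⁻¹ * (3 * L) = 6 / L := by field_simp; norm_num
      nlinarith [mul_nonneg (mul_nonneg hθ0 ha0) hc0]
    have h6L : 6 / L ≤ η / 2 := by
      rw [div_le_div_iff₀ hL0 (by norm_num)]; linarith
    calc exp (-(p * ((1 - θ) * D))) ≤ exp (-c + η / 2) := exp_le_exp.2 (by linarith)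
      _ = exp (-c) * exp (η / 2) := exp_add _ _
      _ ≤ exp (-c) * (1 + η) := by
        gcongr
        have := (abs_le.1 (abs_exp_sub_one_sub_id_le (x := η / 2)
          (by rw [abs_of_pos] <;> linarith))).2
        nlinarith
  have hk0 : (0 : ℝ) ≤ k := Nat.cast_nonneg k
  have hsum : p * (k * W) + (k * exp (-(p * ((1 - θ) * D))) + m * exp (-(p * (1 / 2 * D)))) ≤
      (1 + η) * (α * L) + 1 := by
    have h5 : k * exp (-(p * ((1 - θ) * D))) ≤ k * (exp (-c) * (1 + η)) := by gcongr
    have h6 : m * exp (-(p * (1 / 2 * D))) ≤ 1 :=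
      (mul_le_mul_of_nonneg_left h3 (Nat.cast_nonneg m)).trans hm
    have h7 := mul_le_mul_of_nonneg_left hk (by linarith : (0 : ℝ) ≤ 1 + η)
    linarith
  calc _ ≤ (1 + η) * ((1 + η) * (α * L) + 1) := by gcongr
    _ ≤ _ := by nlinarith

theorem sample_size_bounds {n d c L α b k M : ℝ} {l : ℕ} (hn : 0 < n) (hc : c = d ^ (l + 2) / n)
    (hα : 0 < α) (hα1 : α ≤ 1) (hL : 100 ≤ L) (hdL : 400 * L ^ 17 ≤ d) (hc1 : 1 ≤ c)
    (hc3 : c ≤ 3 * L) (hML : M ≤ L) (hx : d ^ (l + 1) / n + exp (-c) ≤ α / 2)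
    (hb : b = α * ((d ^ (l + 1) / n + exp (-c))⁻¹ * L)) (hk0 : 0 ≤ k) (hkb : k ≤ b)
    (hbk : b < k + 1) :
    k * (d ^ (l + 1) / n + exp (-c)) ≤ α * L ∧ k * c ≤ L * d ∧ k ≤ L * d ∧ k ≤ L * exp c ∧
      L * d ^ (l + 1) ≤ (L ^ 8)⁻¹ * n / 128 ∧ L * d ≤ n ∧ M < k := by
  have hL0 : 0 < L := by linarith
  have hd0 : 0 < d := lt_of_lt_of_le (by positivity) hdL
  have hdl1 : 0 < d ^ (l + 1) := pow_pos hd0 _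
  have hc0 : 0 < c := by linarith
  have hcn : d ^ (l + 2) = c * n := by rw [hc]; field_simp
  have hcd : d ^ (l + 1) / n = c / d := by rw [hc]; field_simp; ring
  have hd1 : 1 ≤ d := by linarith [one_le_pow₀ (n := 17) (by linarith : 1 ≤ L)]
  have hpos : 0 < d ^ (l + 1) / n := by positivity
  set x := d ^ (l + 1) / n + exp (-c) with hxdef
  have hx0 : 0 < x := by positivity
  have hbx : b * x = α * L := by rw [hb]; field_simp
  have hkx : k * x ≤ α * L := hbx ▸ mul_le_mul_of_nonneg_right hkb hx0.le
  have hkxL : k * x ≤ L := hkx.trans (mul_le_of_le_one_left hL0.le hα1)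
  have hkcd : k * c ≤ L * d := by
    have : k * (c / d) ≤ L := by
      refine (mul_le_mul_of_nonneg_left ?_ hk0).trans hkxL
      rw [← hcd]
      linarith only [exp_pos (-c)]
    rwa [← mul_div_assoc, div_le_iff₀ hd0] at this
  have hkc : k ≤ L * exp c := by
    have : k * exp (-c) ≤ L :=
      (mul_le_mul_of_nonneg_left (by linarith only [hpos]) hk0).trans hkxL
    calc k = k * exp (-c) * exp c := by rw [mul_assoc, ← exp_add]; simp
      _ ≤ _ := mul_le_mul_of_nonneg_right this (exp_pos c).le
  have hdd : d * d ≤ 3 * L * n := by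
    calc d * d = d ^ 2 := by ring
      _ ≤ d ^ (l + 2) := pow_le_pow_right₀ hd1 (by omega)
      _ = c * n := hcn
      _ ≤ _ := mul_le_mul_of_nonneg_right hc3 hn.le
  have hdL2 : 3 * L ^ 2 ≤ d := by
    have : L ^ 2 ≤ L ^ 17 := pow_le_pow_right₀ (by linarith) (by norm_num)
    linarith only [this, hdL, sq_nonneg L]
  refine ⟨hkx, hkcd, (le_mul_of_one_le_right hk0 hc1).trans hkcd, hkc, ?_, ?_, ?_⟩
  · have h2 : (L ^ 8)⁻¹ * n / 128 = (L ^ 8)⁻¹ * d * (d ^ (l + 1) / (128 * c)) := by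
      have : n = d ^ (l + 2) / c := by rw [hcn]; field_simp
      rw [this]; ring
    rw [h2]
    calc L * d ^ (l + 1) = 384 * L ^ 2 * (d ^ (l + 1) / (128 * (3 * L))) := by
          field_simp; norm_num
      _ ≤ (L ^ 8)⁻¹ * d * (d ^ (l + 1) / (128 * c)) := by
        have h3 : 384 * L ^ 2 ≤ (L ^ 8)⁻¹ * d := by
          rw [inv_mul_eq_div, le_div_iff₀ (by positivity)]
          have : L ^ 10 ≤ L ^ 17 := pow_le_pow_right₀ (by linarith) (by norm_num)
          calc 384 * L ^ 2 * L ^ 8 = 384 * L ^ 10 := by ring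
            _ ≤ d := by linarith only [this, hdL, pow_pos hL0 10]
        gcongr
  · refine le_of_mul_le_mul_left (a := 3 * L) ?_ (by positivity)
    calc 3 * L * (L * d) = 3 * L ^ 2 * d := by ring
      _ ≤ d * d := mul_le_mul_of_nonneg_right hdL2 hd0.le
      _ ≤ _ := hdd
  · have hb0 : 0 ≤ b := hk0.trans hkb
    have h2 : 2 * L ≤ b := by
      have : b * x ≤ b * (α / 2) := mul_le_mul_of_nonneg_left hx hb0
      rw [hbx] at this
      refine le_of_mul_le_mul_left (a := α / 2) ?_ (by positivity)
      linarith only [this]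
    linarith

theorem ball_bounds {n p d c L ε a k M W D D' : ℝ} {l : ℕ} (hn : 1 ≤ n) (hp : 0 ≤ p)
    (hL : 100 ≤ L) (hd4 : 4 ≤ d) (hc0 : 0 < c) (hk0 : 0 ≤ k)
    (hkcd : k * c ≤ L * d) (hMc : 16 * L < M * c) (hM0 : 0 ≤ M) (hML : M ≤ L) (ha0 : 0 ≤ a)
    (hLa : L * a ≤ 1 / 8) (hpn : p * n ≤ 2 * d)
    (hdlL : L * d ^ (l + 1) ≤ ε * n / 128) (hW : W ≤ 2 * d ^ l)
    (hDD : D' - D ≤ a * d ^ (l + 1)) (hD : 1 / 2 * d ^ (l + 1) ≤ D) :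
    k * W < M * (1 / 2 * D - M * (D' - D)) ∧ 2 * W ≤ ε / 16 * n ∧ p * (2 * W) ≤ ε / 4 := by
  have hd0 : 0 < d := by linarith
  have hn0 : 0 < n := by linarith
  have hdl : 0 < d ^ l := pow_pos hd0 l
  have hdl1 : 0 < d ^ (l + 1) := pow_pos hd0 _
  have hLdl : 100 * d ^ (l + 1) ≤ L * d ^ (l + 1) := mul_le_mul_of_nonneg_right hL hdl1.le
  refine ⟨?_, ?_, ?_⟩
  · refine mul_lt_of_bounds (A := d ^ (l + 1) / 2) ?_ hM0 hDD (by linarith) ?_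
    · refine lt_of_mul_lt_mul_right (a := c) ?_ hc0.le
      calc k * W * c ≤ k * (2 * d ^ l) * c :=
            mul_le_mul_of_nonneg_right (mul_le_mul_of_nonneg_left hW hk0) hc0.le
        _ = k * c * (2 * d ^ l) := by ring
        _ ≤ L * d * (2 * d ^ l) := mul_le_mul_of_nonneg_right hkcd (by positivity)
        _ = 16 * L * (d ^ (l + 1) / 2 / 4) := by ring
        _ < M * c * (d ^ (l + 1) / 2 / 4) := mul_lt_mul_of_pos_right hMc (by positivity)
        _ = _ := by ring
    · have h1 : M * a ≤ 1 / 8 := (mul_le_mul_of_nonneg_right hML ha0).trans hLa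
      have h2 := mul_le_mul_of_nonneg_right h1 hdl1.le
      linarith only [h2]
  · have : d ^ l * 4 ≤ d ^ (l + 1) := by
      rw [pow_succ]
      exact mul_le_mul_of_nonneg_left hd4 hdl.le
    linarith only [this, hLdl, hdlL, hW, hdl1]
  · refine le_of_mul_le_mul_right (a := n) ?_ hn0
    calc p * (2 * W) * n = p * n * (2 * W) := by ring
      _ ≤ p * n * (2 * (2 * d ^ l)) := by
        refine mul_le_mul_of_nonneg_left (by linarith only [hW]) (by positivity)
      _ ≤ 2 * d * (2 * (2 * d ^ l)) := mul_le_mul_of_nonneg_right hpn (by positivity)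
      _ = 8 * d ^ (l + 1) := by ring
      _ ≤ ε / 4 * n := by linarith only [hLdl, hdlL, hdl1]

set_option maxHeartbeats 1000000 in
theorem one_sub_le_gnpProb_of_large {n l M : ℕ} {p d c L η α y₀ : ℝ} (h0 : 0 ≤ p) (h1 : p ≤ 1)
    (hd : d = p * ((n : ℝ) - 1)) (hc : c = d ^ (l + 2) / n) (hLn : L = log n)
    (hη : 0 < η) (hη1 : η ≤ 1) (hα : 0 < α) (hα1 : α ≤ 1)
    (hL : 100 ≤ L) (hLη : 12 ≤ η * L) (hlL : 2 ^ (l + 2) + ((l : ℝ) + 1) ≤ L)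
    (hdL : 400 * L ^ 17 ≤ d) (hc1 : 1 ≤ c) (hc3 : c ≤ 3 * L) (hM : 16 * L < M * c) (hML : M ≤ L)
    (hx : d ^ (l + 1) / n + exp (-c) ≤ α / 2)
    (hy₀ : ∀ y, 0 ≤ y → y ≤ y₀ → exp (-((1 + η) * y)) ≤ 1 - y) (hpy : p ≤ y₀)
    (hcy : exp (-(c / 3)) ≤ y₀)
    (hfin : (2 * (l + 2) + 1) ^ M + L ^ 2 * d + L
      ≤ exp (L - ((1 + η) ^ 2 * (α * L) + 2)) / (128 * L ^ 8)) :
    1 - (exp (-L) + (exp (exp (-L)) - 1) + exp (-L)) ≤ gnpProb n p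
      {G | α * ((d ^ (l + 1) / n + exp (-c))⁻¹ * L) ≤ (metricDim G : ℝ)} := by
  have hL0 : 0 < L := by linarith
  have hexpL : exp L = n := by
    rw [hLn, exp_log]
    rcases Nat.eq_zero_or_pos n with rfl | h
    · simp [hLn] at hL0
    · exact_mod_cast h
  have hnL : L ≤ (n : ℝ) - 1 := by linarith [add_one_le_exp L]
  have hn : (0 : ℝ) < n := by linarith
  have hd0 : 0 < d := lt_of_lt_of_le (by positivity) hdL
  have hdn : d ≤ n := by
    rw [hd]
    linarith only [mul_le_mul_of_nonneg_right h1 (by linarith : (0 : ℝ) ≤ (n : ℝ) - 1)]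
  have hLpow : ∀ j : ℕ, 1 ≤ L ^ j := fun j => one_le_pow₀ (by linarith)
  set ε : ℝ := (L ^ 8)⁻¹ with hε
  set a : ℝ := (L ^ 7)⁻¹ with ha
  have hε0 : 0 < ε := by positivity
  have ha0 : 0 < a := by positivity
  have hLε : L * ε ≤ a := by
    refine le_of_eq ?_
    rw [hε, ha]; field_simp
  have hLa : L * a ≤ 1 / 8 := by
    have : L * a = (L ^ 6)⁻¹ := by rw [ha]; field_simp
    rw [this, inv_le_comm₀ (by positivity) (by norm_num)]
    calc (1 / 8 : ℝ)⁻¹ ≤ L := by norm_num; linarith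
      _ ≤ L ^ 6 := le_self_pow₀ (by linarith) (by norm_num)
  have ha2 : a ≤ (L ^ 2)⁻¹ := by
    rw [ha]
    exact inv_anti₀ (by positivity) (pow_le_pow_right₀ (by linarith) (by norm_num))
  have ha8 : a ≤ 1 / 8 := le_trans (le_mul_of_one_le_left ha0.le (by linarith)) hLa
  have hεa : ε ≤ a := le_trans (le_mul_of_one_le_left hε0.le (by linarith)) hLε
  have hεdL : 400 * L ^ 9 ≤ ε * d := by
    calc 400 * L ^ 9 = ε * (400 * L ^ 17) := by rw [hε]; field_simp
      _ ≤ _ := by gcongr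
  have hεd : 1 ≤ ε * d := by linarith [hLpow 9]
  obtain ⟨hW, hDD, hD⟩ := growth_pow_bounds (l := l) hε0 (by linarith) hεd hlL hLε
  set Δ := (1 + ε) * d with hΔ
  set W := (1 + Δ) ^ l with hWdef
  set D := ((1 - ε) * d) ^ (l + 1) with hDdef
  have hdl : 0 < d ^ l := pow_pos hd0 l
  have hdl1 : 0 < d ^ (l + 1) := pow_pos hd0 _
  have hΔ0 : 0 ≤ Δ := by positivity
  have hW1 : 1 ≤ W := one_le_pow₀ (by linarith)
  have hW2 : W ≤ 2 * d ^ l := hW.trans (by gcongr; linarith)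
  have hD2 : 1 / 2 * d ^ (l + 1) ≤ D := le_trans (by gcongr; linarith) hD
  set b := α * ((d ^ (l + 1) / n + exp (-c))⁻¹ * L) with hb
  have hb0 : 0 ≤ b := by positivity
  set k := ⌊b⌋₊ with hkdef
  have hbk : b < k + 1 := Nat.lt_floor_add_one b
  have hk0 : (0 : ℝ) ≤ k := Nat.cast_nonneg k
  obtain ⟨hkx, hkcd, hkd, hkc, hdlL, hLdn, hMk⟩ := sample_size_bounds hn hc hα hα1 hL hdL hc1 hc3
    hML hx hb hk0 (Nat.floor_le hb0) hbk
  have hMk : M < k := by exact_mod_cast hMk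
  have hkn : k ≤ n := by exact_mod_cast hkd.trans hLdn
  have hpn : p * n ≤ 2 * d := by
    rw [hd]
    linarith only [mul_le_mul_of_nonneg_left (by linarith : (2 : ℝ) ≤ n) h0]
  obtain ⟨hM', hs, hps⟩ := ball_bounds (M := M) (by linarith) h0 hL
    (by linarith [hLpow 17]) (by linarith) hk0 hkcd hM (Nat.cast_nonneg M) hML ha0.le hLa hpn hdlL
    hW2 hDD hD2
  obtain ⟨T, -, hT⟩ := Finset.exists_subset_card_eq (s := (Finset.univ : Finset (Fin n)))
    (n := ⌊ε / 16 * n⌋₊) (by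
      rw [Finset.card_univ, Fintype.card_fin]
      exact Nat.floor_le_of_le (mul_le_of_le_one_left hn.le (by linarith)))
  have hTle : (T.card : ℝ) ≤ ε / 16 * n := hT ▸ Nat.floor_le (by positivity)
  have hTge : ε / 32 * n ≤ T.card := by
    have h2 : ε / 16 * n < T.card + 1 := hT ▸ Nat.lt_floor_add_one _
    have h3 : 400 ≤ ε * n := by
      have : ε * d ≤ ε * n := by gcongr
      linarith [hLpow 9]
    linarith
  obtain ⟨m, hm, hmc⟩ := exists_cutoff hL hdL (by linarith) ha0.le hk0 hkd hkc le_rfl hW2 hDD hD2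
  obtain ⟨hE, hDc⟩ := exponent_le h0 hd hc hη hη1 hL hLη hnL (by linarith) hc3 hd0.le ha0.le ha2
    (inv_nonneg.2 (sq_nonneg L)) le_rfl hW hD hkx hmc
  have hexpands := bernProb_not_expands_le_exp (V := Fin n) (T := T) (s := 2 * W) (d := d) h0 h1 hε0
    (by linarith) (by rwa [Fintype.card_fin]) (by rwa [Fintype.card_fin]) hps
    (by rwa [Fintype.card_fin])
  rw [Fintype.card_fin] at hexpands
  have hnκ : (n : ℝ) * exp (-(ε ^ 2 * d / 4)) ≤ exp (-L) := by
    rw [← hexpL, ← exp_add, exp_le_exp]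
    have : 2 * L ≤ ε ^ 2 * d / 4 := by
      calc 2 * L ≤ 100 * L := by linarith
        _ = ε * (400 * L ^ 9) / 4 := by rw [hε]; field_simp; norm_num
        _ ≤ ε * (ε * d) / 4 := by gcongr
        _ = _ := by ring
    linarith
  set q := exp (-((1 + η) * (p * (k * W) + (k * exp (-(p * ((1 - (L ^ 2)⁻¹) * D)))
        + m * exp (-(p * (1 / 2 * D))))))) with hq
  have hmain := one_sub_le_gnpProb_le_metricDim (n := n) (T := T) (Δ := Δ) (d := (1 - ε) * d)
    (s := 2 * W) (a := 1 / 2 * D) (t := T.card - k * W) (q := q) (b := b) (l := l) (M := M)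
    (k := k) h0 h1 (by linarith) (mul_pos (by linarith) hd0) (exp_pos _).le hkn hbk
    fun G R hG hR => hG.favourable h0 h1 (mul_nonneg (by linarith) hd0.le)
      (by linarith only [hΔ, mul_pos hε0 hd0]) hΔ0 hη.le hM' hm hMk hy₀ hpy (hDc.trans hcy) hR
  refine le_trans ?_ hmain
  have hlast : (n : ℝ) ^ k * exp (log 2 * (2 * (l + 2) + 1) ^ M - (T.card - k * W) * q / 2)
      ≤ exp (-L) := by
    rw [← hexpL, ← exp_nat_mul, ← exp_add, exp_le_exp]
    have h2 : log 2 * (2 * (l + 2) + 1) ^ M ≤ 1 * (2 * ((l : ℝ) + 2) + 1) ^ M := by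
      gcongr
      linarith [log_two_lt_d9]
    have h3 : ε / 64 * n ≤ T.card - k * W := by
      have : k * W ≤ 2 * (L * d ^ (l + 1)) := by
        calc k * W ≤ (L * d) * (2 * d ^ l) :=
              mul_le_mul hkd hW2 (by linarith only [hW1]) (by positivity)
          _ = _ := by ring
      linarith only [this, hdlL, hTge]
    have h4 : exp (-((1 + η) ^ 2 * (α * L) + 2)) ≤ q := exp_le_exp.2 (by linarith)
    have h5 : exp (L - ((1 + η) ^ 2 * (α * L) + 2)) / (128 * L ^ 8)
        ≤ (T.card - k * W) * q / 2 := by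
      calc exp (L - ((1 + η) ^ 2 * (α * L) + 2)) / (128 * L ^ 8)
          = ε / 64 * n * exp (-((1 + η) ^ 2 * (α * L) + 2)) / 2 := by
            rw [sub_eq_add_neg, exp_add, hexpL, hε]; field_simp; norm_num
        _ ≤ _ := by
          have := (by positivity : 0 ≤ ε / 64 * (n : ℝ)).trans h3
          gcongr
    have h6 : k * L ≤ L ^ 2 * d := by
      linarith only [mul_le_mul_of_nonneg_right hkd hL0.le]
    linarith only [h2, h5, h6, hfin]
  have : exp ((n : ℝ) * exp (-(ε ^ 2 * d / 4))) ≤ exp (exp (-L)) := exp_le_exp.2 hnκ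
  linarith

end Parameters

section Asymptotics

theorem exists_pos_forall_exp_neg_le {η : ℝ} (hη : 0 < η) (hη1 : η ≤ 1) :
    ∃ y₀ > 0, ∀ y, 0 ≤ y → y ≤ y₀ → exp (-((1 + η) * y)) ≤ 1 - y := by
  refine ⟨η / 2, by positivity, fun y hy hyη => ?_⟩
  have h := exp_neg_le_quadratic (mul_nonneg (by linarith : 0 ≤ 1 + η) hy)
  have h2 : (1 + η) ^ 2 * y ≤ 4 * (η / 2) := by
    gcongr
    nlinarith
  nlinarith [mul_le_mul_of_nonneg_right h2 hy]

theorem eventually_mul_pow_le_exp {a : ℝ} (ha : 0 < a) (C : ℝ) (k : ℕ) :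
    ∀ᶠ L : ℝ in atTop, C * L ^ k ≤ exp (a * L) := by
  filter_upwards [(isLittleO_pow_exp_pos_mul_atTop k ha).def (c := (|C| + 1)⁻¹) (by positivity),
    eventually_ge_atTop 0] with L hL hL0
  rw [norm_of_nonneg (by positivity), norm_of_nonneg (exp_pos _).le, inv_mul_eq_div,
    le_div_iff₀ (by positivity)] at hL
  nlinarith [le_abs_self C, pow_nonneg hL0 k]

theorem tendsto_inv_log : Tendsto (fun L : ℝ => (log L)⁻¹) atTop (𝓝 0) :=
  tendsto_inv_atTop_zero.comp tendsto_log_atTop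

theorem eventually_ceil_div_log_bounds (C ε B : ℝ) (hC : 0 ≤ C) (hε : 0 < ε) (hB : 1 ≤ B) :
    ∀ᶠ L : ℝ in atTop, (⌈C * L / log L⌉₊ : ℝ) ≤ L ∧ B ^ ⌈C * L / log L⌉₊ ≤ exp (ε * L) := by
  have h : Tendsto (fun L : ℝ => C * (log L)⁻¹) atTop (𝓝 0) := by
    simpa using tendsto_inv_log.const_mul C
  set κ := min 1 (ε / (log B + 1)) with hκ
  have hB0 : 0 ≤ log B := log_nonneg hB
  have hκ0 : 0 < κ := lt_min one_pos (by positivity)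
  have hκB : κ * log B ≤ ε := by
    have : κ * (log B + 1) ≤ ε := (le_div_iff₀ (by positivity)).1 (min_le_right _ _)
    linarith
  filter_upwards [h.eventually_le_const (half_pos hκ0), eventually_ge_atTop 2,
    eventually_ge_atTop (2 / κ)] with L h1 h2 h3
  have hL0 : 0 < L := by linarith
  have hlog : 0 < log L := log_pos (by linarith)
  have hM : (⌈C * L / log L⌉₊ : ℝ) ≤ κ * L := by
    have h4 : 2 ≤ κ * L := by rwa [div_le_iff₀' hκ0] at h3
    have h5 : C * L / log L ≤ κ / 2 * L := by
      calc C * L / log L = C * (log L)⁻¹ * L := by ring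
        _ ≤ _ := by gcongr
    have := (Nat.ceil_lt_add_one (by positivity : 0 ≤ C * L / log L)).le
    linarith
  refine ⟨hM.trans (mul_le_of_le_one_left hL0.le (min_le_left _ _)), ?_⟩
  rw [← exp_log (by positivity : 0 < B ^ ⌈C * L / log L⌉₊), log_pow, exp_le_exp]
  calc (⌈C * L / log L⌉₊ : ℝ) * log B ≤ κ * L * log B := by gcongr
    _ = κ * log B * L := by ring
    _ ≤ _ := by gcongr

theorem eventually_exponent_bound {β δ γ : ℝ} (hβ : 0 < β) (hδ : 0 < δ)
    (hγ : γ ≤ 1 - β - δ / 2) :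
    ∀ᶠ L : ℝ in atTop, ∀ B d : ℝ, B ≤ exp (δ / 4 * L) → d ≤ 3 * L * exp (β * L) →
      B + L ^ 2 * d + L ≤ exp (L - (γ * L + 2)) / (128 * L ^ 8) := by
  filter_upwards [eventually_mul_pow_le_exp (by positivity : 0 < δ / 4) 6400 11,
    eventually_ge_atTop 1] with L h1 hL1 B d hB hd
  have hL0 : 0 < L := by linarith
  have hE1 : 1 ≤ exp (β * L) := one_le_exp (by positivity)
  have hE2 : 1 ≤ exp (δ / 4 * L) := one_le_exp (by positivity)
  set E := exp (β * L)
  set F := exp (δ / 4 * L) with hF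
  have hL3 : L ≤ L ^ 3 := le_self_pow₀ hL1 (by norm_num)
  have hEF : 1 ≤ E * F := one_le_mul_of_one_le_of_one_le hE1 hE2
  have hsum : B + L ^ 2 * d + L ≤ 5 * L ^ 3 * (E * F) := by
    have h2 : B ≤ L ^ 3 * (E * F) := by
      calc B ≤ 1 * (1 * F) := by linarith
        _ ≤ _ := by gcongr; linarith
    have h3 : L ^ 2 * d ≤ 3 * L ^ 3 * (E * F) := by
      calc L ^ 2 * d ≤ L ^ 2 * (3 * L * E) := by gcongr
        _ = 3 * L ^ 3 * (E * 1) := by ring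
        _ ≤ _ := by gcongr
    have h4 : L ≤ L ^ 3 * (E * F) := hL3.trans (le_mul_of_one_le_right (by positivity) hEF)
    linarith
  rw [le_div_iff₀ (by positivity)]
  have he2 : exp 2 ≤ 10 := by
    have : exp 2 = exp 1 * exp 1 := by rw [← exp_add]; norm_num
    rw [this]
    nlinarith [exp_one_lt_d9, exp_pos 1]
  have hexp : E * F * F ≤ exp (L - (γ * L + 2)) * 10 := by
    calc E * F * F = exp (β * L + δ / 4 * L + δ / 4 * L) := by rw [exp_add, exp_add]
      _ ≤ exp (L - (γ * L + 2) + 2) := by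
        rw [exp_le_exp]
        nlinarith
      _ = exp (L - (γ * L + 2)) * exp 2 := exp_add _ _
      _ ≤ _ := by gcongr
  have : (B + L ^ 2 * d + L) * (128 * L ^ 8) ≤ 6400 * L ^ 11 * (E * F) / 10 := by
    calc _ ≤ 5 * L ^ 3 * (E * F) * (128 * L ^ 8) := by gcongr
      _ = _ := by ring
  have h5 : 6400 * L ^ 11 * (E * F) ≤ F * (E * F) := by gcongr
  linarith

theorem eventually_half_log_le :
    ∀ᶠ L : ℝ in atTop, ∀ c, L / (3 * log L) < exp c → 1 / 2 * log L ≤ c := by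
  filter_upwards [(isLittleO_log_rpow_atTop (r := 1 / 2) (by norm_num)).def
    (c := 1 / 3) (by norm_num), eventually_ge_atTop 2] with L h1 hL c hc
  have hlog : 0 < log L := log_pos (by linarith)
  have hL0 : 0 < L := by linarith
  rw [norm_of_nonneg hlog.le, norm_of_nonneg (by positivity)] at h1
  rw [← exp_le_exp]
  refine le_trans ?_ hc.le
  have h2 : exp (1 / 2 * log L) = L ^ (1 / 2 : ℝ) := by rw [rpow_def_of_pos hL0, mul_comm]
  rw [h2, le_div_iff₀ (by positivity)]
  calc L ^ (1 / 2 : ℝ) * (3 * log L) ≤ L ^ (1 / 2 : ℝ) * L ^ (1 / 2 : ℝ) := by gcongr; linarith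
    _ = L := by rw [← rpow_add hL0]; norm_num

theorem degree_bounds {n d c L : ℝ} {l : ℕ} (hn : 0 < n) (hd : 0 ≤ d) (hL : log n = L)
    (hL1 : 1 ≤ L) (hc : c = d ^ (l + 2) / n) (hc1 : 1 ≤ c) (hc3 : c ≤ 3 * L) :
    exp (((l : ℝ) + 2)⁻¹ * L) ≤ d ∧ d ≤ 3 * L * exp (((l : ℝ) + 2)⁻¹ * L) := by
  have hcn : d ^ (l + 2) = c * n := by rw [hc]; field_simp
  have hpow : exp (((l : ℝ) + 2)⁻¹ * L) ^ (l + 2) = n := by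
    rw [← exp_nat_mul, ← exp_log hn, hL]
    congr 1
    push_cast
    field_simp
  constructor
  · refine le_of_pow_le_pow_left₀ (n := l + 2) (by omega) hd ?_
    rw [hpow, hcn]
    exact le_mul_of_one_le_left hn.le hc1
  · refine le_of_pow_le_pow_left₀ (n := l + 2) (by omega) (by positivity) ?_
    rw [mul_pow, hpow, hcn]
    gcongr
    exact hc3.trans (le_self_pow₀ (by linarith) (by omega))

theorem gnpProb_le_one {n : ℕ} {p : ℝ} (h0 : 0 ≤ p) (h1 : p ≤ 1)
    (A : Set (SimpleGraph (Fin n))) : gnpProb n p A ≤ 1 := by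
  rw [gnpProb_eq]
  exact bernProb_le_one h0 h1 _

theorem gnpProb_eq_one {n : ℕ} {p : ℝ} {A : Set (SimpleGraph (Fin n))} (h : ∀ G, G ∈ A) :
    gnpProb n p A = 1 := by
  rw [gnpProb_eq]
  simp only [bernProb, h, if_true]
  exact bernExp_const 1

theorem tendsto_one_sub_exp_neg_errors :
    Tendsto (fun L : ℝ => 1 - (exp (-L) + (exp (exp (-L)) - 1) + exp (-L))) atTop (𝓝 1) := by
  have h := tendsto_exp_neg_atTop_nhds_zero
  have h2 : Tendsto (fun L : ℝ => exp (exp (-L))) atTop (𝓝 (exp 0)) :=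
    (continuous_exp.tendsto 0).comp h
  simpa using ((h.add (h2.sub_const 1)).add h).const_sub 1

theorem exists_one_add_sq_mul_le {α γ : ℝ} (hα : 0 < α) (hα1 : α ≤ 1) (h : α < γ) :
    ∃ η, 0 < η ∧ η ≤ 1 ∧ (1 + η) ^ 2 * α ≤ γ := by
  refine ⟨min 1 ((γ - α) / 3), lt_min one_pos (by linarith), min_le_left _ _, ?_⟩
  have h1 := min_le_left 1 ((γ - α) / 3)
  have h2 := min_le_right 1 ((γ - α) / 3)
  have h3 : 0 < min 1 ((γ - α) / 3) := lt_min one_pos (by linarith)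
  set η := min 1 ((γ - α) / 3)
  calc (1 + η) ^ 2 * α ≤ (1 + 3 * η) * α := by gcongr; nlinarith
    _ = α + 3 * η * α := by ring
    _ ≤ α + 3 * η * 1 := by gcongr
    _ ≤ γ := by linarith

/-- The lower bound for the metric dimension when the leading constant is positive. -/
theorem tendsto_gnpProb_le_metricDim {p d c : ℕ → ℝ} {l : ℕ} (hp : ∀ n, 0 ≤ p n ∧ p n ≤ 1)
    (hd : ∀ n, d n = p n * ((n : ℝ) - 1))
    (hd_upper : (fun n : ℕ => d n) =o[atTop] (fun n : ℕ => (n : ℝ)))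
    (hi : (fun n : ℕ => d n ^ (l + 1)) =o[atTop] (fun n : ℕ => (n : ℝ)))
    (hc : ∀ n : ℕ, c n = d n ^ (l + 2) / n)
    (hec : ∀ᶠ n : ℕ in atTop, log n / (3 * log (log n)) < exp (c n))
    (hc3 : ∀ᶠ n : ℕ in atTop, c n ≤ 3 * log n) {α δ : ℝ} (hα : 0 < α) (hδ : 0 < δ)
    (hαδ : α = 1 - ((l : ℝ) + 2)⁻¹ - δ) :
    Tendsto (fun n : ℕ => gnpProb n (p n)
      {G | α * ((d n ^ (l + 1) / n + exp (-c n))⁻¹ * log n) ≤ (metricDim G : ℝ)})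
      atTop (𝓝 1) := by
  have hβ : 0 < ((l : ℝ) + 2)⁻¹ := by positivity
  have hα1 : α ≤ 1 := by linarith
  obtain ⟨η, hη, hη1, hηα⟩ := exists_one_add_sq_mul_le hα hα1
    (by linarith : α < 1 - ((l : ℝ) + 2)⁻¹ - δ / 2)
  obtain ⟨y₀, hy₀, hy⟩ := exists_pos_forall_exp_neg_le hη hη1
  have hlog : Tendsto (fun n : ℕ => log n) atTop atTop :=
    tendsto_log_atTop.comp tendsto_natCast_atTop_atTop
  have hchalf : ∀ᶠ n : ℕ in atTop, 1 / 2 * log (log n) ≤ c n := by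
    filter_upwards [hlog.eventually eventually_half_log_le, hec] with n h1 h2 using h1 _ h2
  have hctop : Tendsto c atTop atTop := tendsto_atTop_mono' _ hchalf
    ((tendsto_log_atTop.comp hlog).const_mul_atTop (by norm_num))
  have hexpc : ∀ {r : ℝ}, 0 < r → Tendsto (fun n => exp (-(c n / r))) atTop (𝓝 0) := fun hr =>
    tendsto_exp_neg_atTop_nhds_zero.comp (hctop.atTop_div_const hr)
  refine tendsto_of_tendsto_of_tendsto_of_le_of_le'
    (tendsto_one_sub_exp_neg_errors.comp hlog) tendsto_const_nhds ?_
    (Eventually.of_forall fun n => gnpProb_le_one (hp n).1 (hp n).2 _)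
  filter_upwards [hchalf, hc3, hctop.eventually_ge_atTop 1,
    (hexpc (by norm_num : (0 : ℝ) < 3)).eventually_le_const hy₀,
    (hexpc one_pos).eventually_le_const (by positivity : 0 < α / 4),
    hi.def (by positivity : 0 < α / 4), hd_upper.def (by positivity : 0 < y₀ / 2),
    eventually_ge_atTop 2, hlog.eventually_ge_atTop 100, hlog.eventually_ge_atTop (12 / η),
    hlog.eventually_ge_atTop (2 ^ (l + 2) + ((l : ℝ) + 1)),
    hlog.eventually (eventually_mul_pow_le_exp hβ 400 17),
    hlog.eventually (eventually_ceil_div_log_bounds 40 (δ / 4) (2 * ((l : ℝ) + 2) + 1)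
      (by norm_num) (by positivity) (by linarith [(Nat.cast_nonneg l : (0 : ℝ) ≤ l)])),
    hlog.eventually (eventually_exponent_bound hβ hδ hηα)]
    with n hch hc3 hc1 hcy hcα hiα hdy hn2 hL hLη hLl hL17 hM hfin
  have hn : (2 : ℝ) ≤ n := by exact_mod_cast hn2
  have hd0 : 0 ≤ d n := by
    rw [hd]
    exact mul_nonneg (hp n).1 (by linarith)
  obtain ⟨hdlow, hdup⟩ := degree_bounds (by linarith) hd0 rfl (by linarith) (hc n) hc1 hc3
  rw [norm_of_nonneg (by positivity), norm_of_nonneg (by positivity)] at hiα hdy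
  have hloglog : 0 < log (log n) := log_pos (by linarith)
  refine one_sub_le_gnpProb_of_large (M := ⌈40 * log n / log (log n)⌉₊) (η := η) (y₀ := y₀)
    (hp n).1 (hp n).2 (hd n) (hc n) rfl hη hη1 hα hα1 hL ((div_le_iff₀' hη).1 hLη) hLl
    (hL17.trans hdlow) hc1 hc3 ?_ hM.1 ?_ hy ?_ hcy ?_
  · have h1 : 40 * log n / log (log n) * (1 / 2 * log (log n)) ≤
        ⌈40 * log n / log (log n)⌉₊ * c n :=
      mul_le_mul (Nat.le_ceil _) hch (by positivity) (Nat.cast_nonneg _)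
    have h2 : 40 * log n / log (log n) * (1 / 2 * log (log n)) = 20 * log n := by
      field_simp; norm_num
    linarith
  · have h1 : d n ^ (l + 1) / n ≤ α / 4 := (div_le_iff₀ (by linarith)).2 hiα
    rw [div_one] at hcα
    linarith
  · refine le_of_mul_le_mul_right (a := (n : ℝ) - 1) ?_ (by linarith)
    rw [← hd]
    nlinarith
  · have := hfin _ (d n) hM.2 hdup
    rwa [← mul_assoc]
end Asymptotics

/-- Theorem 4.4: if `log³ n ≪ d = o(n)`, `e^c > log n/(3 log log n)` and
`c ≤ 3 log n`, then a.a.s. `β(G) ≥ (i/(i+1)+o(1))·(d^i/n + e^{-c})⁻¹·log n`. -/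
theorem stmt_13 (p d c : ℕ → ℝ)
    (hp : ∀ n, 0 ≤ p n ∧ p n ≤ 1)
    (hd : ∀ n, d n = p n * ((n : ℝ) - 1))
    (hd_lower : Tendsto (fun n : ℕ => d n / (Real.log n) ^ 3) atTop atTop)
    (hd_upper : (fun n : ℕ => d n) =o[atTop] (fun n : ℕ => (n : ℝ)))
    (i : ℕ) (hi1 : 1 ≤ i)
    (hi : (fun n : ℕ => d n ^ i) =o[atTop] (fun n : ℕ => (n : ℝ)))
    (hi_max : ∀ j : ℕ, ((fun n : ℕ => d n ^ j) =o[atTop] (fun n : ℕ => (n : ℝ))) → j ≤ i)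
    (hc : ∀ n : ℕ, c n = d n ^ (i + 1) / n)
    (hec : ∀ᶠ n : ℕ in atTop,
      Real.log n / (3 * Real.log (Real.log n)) < Real.exp (c n))
    (hc3 : ∀ᶠ n : ℕ in atTop, c n ≤ 3 * Real.log n) :
    ∀ δ : ℝ, 0 < δ →
      Tendsto (fun n : ℕ => gnpProb n (p n)
        {G : SimpleGraph (Fin n) |
          ((i : ℝ) / ((i : ℝ) + 1) - δ) *
              ((d n ^ i / n + Real.exp (-c n))⁻¹ * Real.log n) ≤
            (metricDim G : ℝ)})
        atTop (𝓝 1) := by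
  obtain ⟨l, rfl⟩ : ∃ l, i = l + 1 := ⟨i - 1, by omega⟩
  intro δ hδ
  have hcast : (((l + 1 : ℕ) : ℝ)) / (((l + 1 : ℕ) : ℝ) + 1) - δ
      = 1 - ((l : ℝ) + 2)⁻¹ - δ := by
    push_cast
    have : (l : ℝ) + 2 ≠ 0 := by positivity
    rw [show (l : ℝ) + 1 + 1 = l + 2 by ring]
    field_simp
    ring
  rcases le_or_gt ((((l + 1 : ℕ) : ℝ)) / (((l + 1 : ℕ) : ℝ) + 1) - δ) 0 with hα | hα
  · refine tendsto_const_nhds.congr' ?_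
    filter_upwards [eventually_ge_atTop 1] with n hn
    refine (gnpProb_eq_one fun G => ?_).symm
    have hn1 : (1 : ℝ) ≤ n := by exact_mod_cast hn
    have hd0 : 0 ≤ d n := by
      rw [hd]
      exact mul_nonneg (hp n).1 (by linarith)
    have hlog : 0 ≤ log n := log_nonneg hn1
    exact (mul_nonpos_of_nonpos_of_nonneg hα (by positivity)).trans (Nat.cast_nonneg _)
  · exact tendsto_gnpProb_le_metricDim hp hd hd_upper hi hc hec hc3 hα hδ hcast
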